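/- Let (R, m, k) be a commutative noetherian local ring and M an R-module. Suppose n is an integer with H^i_m(M) = 0 for all i > n (that is, n ≥ sup of the degrees of nonvanishing local cohomology of M supported at m). If Ext^n_R(k, M) = 0, then Ext^i_R(k, M) = 0 for all i ≥ n, and moreover sup{ i : Ext^i_R(k, M) ≠ 0 } = depth R − width_R M. -/

import Mathlib

open CategoryTheory Opposite

noncomputable section

/-- The `n`-th Ext group of `R`-modules `X` and `M`, i.e. `Ext^n_R(X, M)`. -/
def extModule (R : Type) [CommRing R] (n : ℕ) (X M : ModuleCat R) : ModuleCat R :=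
  ((Ext R (ModuleCat R) n).obj (op X)).obj M

/-- The `n`-th Tor group of `R`-modules `X` and `M`, i.e. `Tor_n^R(X, M)`. -/
def torModule (R : Type) [CommRing R] (n : ℕ) (X M : ModuleCat R) : ModuleCat R :=
  ((Tor (ModuleCat R) n).obj X).obj M

/-- The residue field `k(p) = R_p / p R_p` at a prime ideal `p`. -/
abbrev resField (R : Type) [CommRing R] (p : Ideal R) [p.IsPrime] : Type :=
  IsLocalRing.ResidueField (Localization.AtPrime p)

/-- `depth_R M := inf{ i : Ext^i_R(k, M) ≠ 0 }`, as an extended real (`⊤ = ∞` if all vanish). -/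
noncomputable def edepth (R : Type) [CommRing R] (k M : ModuleCat R) : EReal :=
  sInf {x : EReal | ∃ i : ℕ, x = (i : EReal) ∧ Nontrivial (extModule R i k M)}

/-- `width_R M := inf{ i : Tor_i^R(k, M) ≠ 0 }`, as an extended real (`⊤ = ∞` if all vanish). -/
noncomputable def ewidth (R : Type) [CommRing R] (k M : ModuleCat R) : EReal :=
  sInf {x : EReal | ∃ i : ℕ, x = (i : EReal) ∧ Nontrivial (torModule R i k M)}

/-- `sup{ i : Ext^i_R(k, M) ≠ 0 }`, as an extended real (`⊥ = -∞` if all vanish). -/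
noncomputable def extSup (R : Type) [CommRing R] (k M : ModuleCat R) : EReal :=
  sSup {x : EReal | ∃ i : ℕ, x = (i : EReal) ∧ Nontrivial (extModule R i k M)}

/-- `sup{ i : Tor_i^R(k, M) ≠ 0 }`, as an extended real (`⊥ = -∞` if all vanish). -/
noncomputable def torSup (R : Type) [CommRing R] (k M : ModuleCat R) : EReal :=
  sSup {x : EReal | ∃ i : ℕ, x = (i : EReal) ∧ Nontrivial (torModule R i k M)}

section Helpers

open scoped TensorProduct

variable {R : Type} [CommRing R]

local notation "κ" => IsLocalRing.ResidueField R
local notation "𝔪" => IsLocalRing.maximalIdeal R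

section ExtRows

/-- Precomposition with a fixed map `a` and a fixed map `b` is exact in `Hom(-, N)`. -/
def HomExact {A B C : Type} [AddCommGroup A] [Module R A] [AddCommGroup B] [Module R B]
    [AddCommGroup C] [Module R C] (a : A →ₗ[R] B) (b : B →ₗ[R] C)
    (N : Type) [AddCommGroup N] [Module R N] : Prop :=
  ∀ f : B →ₗ[R] N, f ∘ₗ a = 0 → ∃ g : C →ₗ[R] N, g ∘ₗ b = f

lemma subsingleton_extModule_succ_iff {X : ModuleCat.{0} R} (P : ProjectiveResolution X)
    (n : ℕ) (Y : ModuleCat.{0} R) :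
    Subsingleton (extModule R (n + 1) X Y) ↔
      HomExact (P.complex.d (n + 2) (n + 1)).hom (P.complex.d (n + 1) n).hom Y := by
  rw [extModule, (P.isoExt (n + 1) Y).toLinearEquiv.toEquiv.subsingleton_congr,
    ← ModuleCat.isZero_iff_subsingleton, ← HomologicalComplex.exactAt_iff_isZero_homology,
    HomologicalComplex.exactAt_iff' _ n (n + 1) (n + 2) (by simp) (by simp),
    ShortComplex.moduleCat_exact_iff]
  constructor
  · intro h f hf
    obtain ⟨g, hg⟩ := h (ModuleCat.ofHom f) (by
      change P.complex.d (n + 2) (n + 1) ≫ ModuleCat.ofHom f = 0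
      ext1; exact hf)
    exact ⟨ModuleCat.Hom.hom (R := R) g, congrArg ModuleCat.Hom.hom
      (show P.complex.d (n + 1) n ≫ g = ModuleCat.ofHom f from hg)⟩
  · intro h f hf
    obtain ⟨g, hg⟩ := h (ModuleCat.Hom.hom (R := R) f)
      (congrArg ModuleCat.Hom.hom (show P.complex.d (n + 2) (n + 1) ≫ f = 0 from hf))
    refine ⟨ModuleCat.ofHom g, ?_⟩
    change P.complex.d (n + 1) n ≫ ModuleCat.ofHom g = f
    ext1; exact hg

lemma subsingleton_extModule_zero_iff {X : ModuleCat.{0} R} (P : ProjectiveResolution X)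
    (Y : ModuleCat.{0} R) :
    Subsingleton (extModule R 0 X Y) ↔
      ∀ f : P.complex.X 0 →ₗ[R] Y, f ∘ₗ (P.complex.d 1 0).hom = 0 → f = 0 := by
  rw [extModule, (P.isoExt 0 Y).toLinearEquiv.toEquiv.subsingleton_congr,
    ← ModuleCat.isZero_iff_subsingleton, ← HomologicalComplex.exactAt_iff_isZero_homology,
    HomologicalComplex.exactAt_iff' _ 0 0 1 (by simp) (by simp),
    ShortComplex.moduleCat_exact_iff]
  constructor
  · intro h f hf
    obtain ⟨g, hg⟩ := h (ModuleCat.ofHom f) (by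
      change P.complex.d 1 0 ≫ ModuleCat.ofHom f = 0
      ext1; exact hf)
    let g' : P.complex.X 0 ⟶ Y := g
    have : P.complex.d 0 0 ≫ g' = ModuleCat.ofHom f := hg
    rw [P.complex.shape 0 0 (by simp), Limits.zero_comp] at this
    exact (congrArg ModuleCat.Hom.hom this).symm
  · intro h f hf
    have := h (ModuleCat.Hom.hom (R := R) f)
      (congrArg ModuleCat.Hom.hom (show P.complex.d 1 0 ≫ f = 0 from hf))
    refine ⟨0, ?_⟩
    rw [map_zero]
    symm
    exact ModuleCat.hom_ext (N := Y) (M := P.complex.X 0) this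

lemma subsingleton_ext_succ_iff {X : ModuleCat.{0} R} (P : ProjectiveResolution X)
    (n : ℕ) (Y : ModuleCat.{0} R) :
    Subsingleton (Abelian.Ext X Y (n + 1)) ↔
      HomExact (P.complex.d (n + 2) (n + 1)).hom (P.complex.d (n + 1) n).hom Y := by
  constructor
  · intro h f hf
    obtain ⟨g, hg⟩ := (P.extMk_eq_zero_iff (ModuleCat.ofHom f) (n + 2) rfl
      (by ext1; exact hf) n rfl).1 (Subsingleton.elim _ _)
    exact ⟨g.hom, congrArg ModuleCat.Hom.hom hg⟩
  · intro h
    refine subsingleton_of_forall_eq 0 fun x => ?_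
    obtain ⟨f, hf, rfl⟩ := P.extMk_surjective x (n + 2) rfl
    obtain ⟨g, hg⟩ := h f.hom (congrArg ModuleCat.Hom.hom hf)
    exact (P.extMk_eq_zero_iff _ _ _ _ n rfl).2 ⟨ModuleCat.ofHom g, by ext1; exact hg⟩

lemma subsingleton_ext_zero_iff {X : ModuleCat.{0} R} (P : ProjectiveResolution X)
    (Y : ModuleCat.{0} R) :
    Subsingleton (Abelian.Ext X Y 0) ↔
      ∀ f : P.complex.X 0 →ₗ[R] Y, f ∘ₗ (P.complex.d 1 0).hom = 0 → f = 0 := by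
  rw [Abelian.Ext.homEquiv₀.subsingleton_congr]
  constructor
  · intro h f hf
    have hf' : P.complex.d 1 0 ≫ ModuleCat.ofHom f = 0 := by ext1; exact hf
    let S := ShortComplex.mk _ _ P.complex_d_comp_π_f_zero
    have hS : S.Exact := P.exact₀
    have := hS.g_desc (ModuleCat.ofHom f) hf'
    have h2 : hS.desc (ModuleCat.ofHom f) hf' = 0 := h.elim _ _
    rw [h2, Limits.comp_zero] at this
    exact (congrArg ModuleCat.Hom.hom this).symm
  · intro h
    refine subsingleton_of_forall_eq 0 fun x => ?_
    let p : P.complex.X 0 ⟶ X := P.π.f 0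
    have : Epi p := inferInstanceAs (Epi (P.π.f 0))
    have hp : P.complex.d 1 0 ≫ p = 0 := P.complex_d_comp_π_f_zero
    rw [← cancel_epi p, Limits.comp_zero]
    ext1
    exact h (p ≫ x).hom (by
      rw [← ModuleCat.hom_comp, reassoc_of% hp, Limits.zero_comp]; rfl)

lemma subsingleton_extModule_iff (n : ℕ) (X Y : ModuleCat.{0} R) :
    Subsingleton (extModule R n X Y) ↔ Subsingleton (Abelian.Ext X Y n) := by
  let P := ProjectiveResolution.of X
  cases n with
  | zero => rw [subsingleton_extModule_zero_iff P, subsingleton_ext_zero_iff P]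
  | succ n => rw [subsingleton_extModule_succ_iff P, subsingleton_ext_succ_iff P]

end ExtRows

section ExtVanishing

/-- `Ext^n_R(X, N) = 0`. -/
def ExtVan (R : Type) [CommRing R] (n : ℕ) (X N : Type) [AddCommGroup X] [Module R X]
    [AddCommGroup N] [Module R N] : Prop :=
  Subsingleton (Abelian.Ext (ModuleCat.of R X) (ModuleCat.of R N) n)

namespace ExtVan

open Abelian

variable {X N N₁ N₂ N₃ X₁ X₂ X₃ : Type} [AddCommGroup X] [Module R X]
  [AddCommGroup N] [Module R N]
  [AddCommGroup N₁] [Module R N₁] [AddCommGroup N₂] [Module R N₂] [AddCommGroup N₃] [Module R N₃]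
  [AddCommGroup X₁] [Module R X₁] [AddCommGroup X₂] [Module R X₂] [AddCommGroup X₃] [Module R X₃]

lemma shortExact {f : N₁ →ₗ[R] N₂} {g : N₂ →ₗ[R] N₃} (hf : Function.Injective f)
    (hfg : Function.Exact f g) (hg : Function.Surjective g) :
    (ShortComplex.mk (ModuleCat.ofHom f) (ModuleCat.ofHom g)
      (by ext x; exact hfg.apply_apply_eq_zero x)).ShortExact where
  exact := (ShortComplex.ShortExact.moduleCat_exact_iff_function_exact _).mpr hfg
  mono_f := (ModuleCat.mono_iff_injective _).2 hf
  epi_g := (ModuleCat.epi_iff_surjective _).2 hg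

section Covariant

variable {f : N₁ →ₗ[R] N₂} {g : N₂ →ₗ[R] N₃} (hf : Function.Injective f)
    (hfg : Function.Exact f g) (hg : Function.Surjective g)
include hf hfg hg

lemma cov_left {n : ℕ} (h3 : ExtVan R n X N₃) (h2 : ExtVan R (n + 1) X N₂) :
    ExtVan R (n + 1) X N₁ := by
  refine subsingleton_of_forall_eq 0 fun x => ?_
  obtain ⟨y, rfl⟩ := Ext.covariant_sequence_exact₁ _ (shortExact hf hfg hg) x
    (@Subsingleton.elim _ h2 _ _) rfl
  rw [@Subsingleton.elim _ h3 y 0, Ext.zero_comp]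

lemma cov_mid {n : ℕ} (h1 : ExtVan R n X N₁) (h3 : ExtVan R n X N₃) :
    ExtVan R n X N₂ := by
  refine subsingleton_of_forall_eq 0 fun x => ?_
  obtain ⟨y, rfl⟩ := Ext.covariant_sequence_exact₂ _ (shortExact hf hfg hg) x
    (@Subsingleton.elim _ h3 _ _)
  rw [@Subsingleton.elim _ h1 y 0, Ext.zero_comp]

lemma cov_right {n : ℕ} (h2 : ExtVan R n X N₂) (h1 : ExtVan R (n + 1) X N₁) :
    ExtVan R n X N₃ := by
  refine subsingleton_of_forall_eq 0 fun x => ?_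
  obtain ⟨y, rfl⟩ := Ext.covariant_sequence_exact₃ _ (shortExact hf hfg hg) x rfl
    (@Subsingleton.elim _ h1 _ _)
  rw [@Subsingleton.elim _ h2 y 0, Ext.zero_comp]

lemma one_of_exists_lift (h2 : ExtVan R 1 X N₂)
    (h : ∀ u : X →ₗ[R] N₃, ∃ v : X →ₗ[R] N₂, g ∘ₗ v = u) : ExtVan R 1 X N₁ := by
  refine subsingleton_of_forall_eq 0 fun x => ?_
  obtain ⟨y, rfl⟩ := Ext.covariant_sequence_exact₁ _ (shortExact hf hfg hg) x
    (@Subsingleton.elim _ h2 _ _) (zero_add 1)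
  obtain ⟨u, rfl⟩ := Ext.homEquiv₀.symm.surjective y
  obtain ⟨v, hv⟩ := h u.hom
  have : u = ModuleCat.ofHom v ≫ ModuleCat.ofHom g := by ext1; exact hv.symm
  rw [Ext.homEquiv₀_symm_apply, this, ← Ext.mk₀_comp_mk₀, Ext.comp_assoc_of_second_deg_zero]
  erw [ShortComplex.ShortExact.comp_extClass (shortExact hf hfg hg)]
  rw [Ext.comp_zero]

end Covariant

section Contravariant

variable {f : X₁ →ₗ[R] X₂} {g : X₂ →ₗ[R] X₃} (hf : Function.Injective f)
    (hfg : Function.Exact f g) (hg : Function.Surjective g)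
include hf hfg hg

lemma contra_mid {n : ℕ} (h1 : ExtVan R n X₁ N) (h3 : ExtVan R n X₃ N) :
    ExtVan R n X₂ N := by
  refine subsingleton_of_forall_eq 0 fun x => ?_
  obtain ⟨y, rfl⟩ := Ext.contravariant_sequence_exact₂ (shortExact hf hfg hg) _ x
    (@Subsingleton.elim _ h1 _ _)
  rw [@Subsingleton.elim _ h3 y 0, Ext.comp_zero]

lemma contra_injective {n : ℕ} (h1 : ExtVan R n X₁ N) :
    Function.Injective ((Ext.mk₀ (ModuleCat.ofHom g)).precomp (ModuleCat.of R N)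
      (zero_add (n + 1))) := by
  rw [injective_iff_map_eq_zero]
  intro x hx
  obtain ⟨y, rfl⟩ := Ext.contravariant_sequence_exact₃ (shortExact hf hfg hg) _ x hx (add_comm 1 n)
  rw [@Subsingleton.elim _ h1 y 0, Ext.comp_zero]

lemma exists_extend (h : ExtVan R 1 X₃ N) (u : X₁ →ₗ[R] N) : ∃ v : X₂ →ₗ[R] N, v ∘ₗ f = u := by
  obtain ⟨y, hy⟩ := Ext.contravariant_sequence_exact₁ (shortExact hf hfg hg) _
    (Ext.mk₀ (ModuleCat.ofHom u)) (add_zero 1) (@Subsingleton.elim _ h _ _)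
  obtain ⟨v, rfl⟩ := Ext.homEquiv₀.symm.surjective y
  refine ⟨v.hom, ?_⟩
  rw [Ext.homEquiv₀_symm_apply, Ext.mk₀_comp_mk₀] at hy
  exact congrArg ModuleCat.Hom.hom (Ext.homEquiv₀.symm.injective hy)

end Contravariant

lemma congr_right {n : ℕ} (e : N₁ ≃ₗ[R] N₂) (h : ExtVan R n X N₁) : ExtVan R n X N₂ := by
  refine cov_mid (f := e.toLinearMap) (g := (0 : N₂ →ₗ[R] PUnit)) e.injective
    (fun x => ?_) (fun x => ⟨0, rfl⟩) h ?_
  · simp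
  · refine subsingleton_of_forall_eq 0 fun x => ?_
    have : (𝟙 (ModuleCat.of R PUnit) : _ ⟶ _) = 0 := by ext
    rw [← x.comp_mk₀_id, this, Ext.mk₀_zero, Ext.comp_zero]

lemma congr_left {n : ℕ} (e : X₁ ≃ₗ[R] X₂) (h : ExtVan R n X₁ N) : ExtVan R n X₂ N := by
  refine subsingleton_of_forall_eq 0 fun x => ?_
  have : x = (Ext.mk₀ (e.toModuleIso.inv ≫ e.toModuleIso.hom)).comp x (zero_add n) := by
    rw [Iso.inv_hom_id, Ext.mk₀_id_comp]
  rw [this, ← Ext.mk₀_comp_mk₀, Ext.comp_assoc_of_second_deg_zero,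
    @Subsingleton.elim _ h ((Ext.mk₀ e.toModuleIso.hom).comp x (zero_add n)) 0, Ext.comp_zero]

lemma of_injective [hN : Module.Injective R N] (n : ℕ) : ExtVan R (n + 1) X N := by
  have : Injective (ModuleCat.of R N) := (Module.injective_iff_injective_object R N).1 hN
  exact subsingleton_of_forall_eq 0 fun x => Ext.eq_zero_of_injective x

lemma of_subsingleton [Subsingleton N] (n : ℕ) : ExtVan R n X N := by
  refine subsingleton_of_forall_eq 0 fun x => ?_
  have : (𝟙 (ModuleCat.of R N) : _ ⟶ _) = 0 := by ext; exact Subsingleton.elim (α := N) _ _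
  rw [← x.comp_mk₀_id, this, Ext.mk₀_zero, Ext.comp_zero]

lemma of_subsingleton_left [Subsingleton X] (n : ℕ) : ExtVan R n X N := by
  refine subsingleton_of_forall_eq 0 fun x => ?_
  have : (𝟙 (ModuleCat.of R X) : _ ⟶ _) = 0 := by ext; exact Subsingleton.elim (α := X) _ _
  rw [← x.mk₀_id_comp, this, Ext.mk₀_zero, Ext.zero_comp]

lemma prod {n : ℕ} (h1 : ExtVan R n X N₁) (h2 : ExtVan R n X N₂) : ExtVan R n X (N₁ × N₂) :=
  cov_mid LinearMap.inl_injective Function.Exact.inl_snd Prod.snd_surjective h1 h2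

lemma zero_iff : ExtVan R 0 X N ↔ ∀ f : X →ₗ[R] N, f = 0 := by
  rw [ExtVan, Ext.homEquiv₀.subsingleton_congr]
  constructor
  · intro h f
    exact congrArg ModuleCat.Hom.hom (h.elim (ModuleCat.ofHom f) 0)
  · intro h
    exact subsingleton_of_forall_eq 0 fun x => by ext1; exact h x.hom

/-- If `r` kills `X` and acts bijectively on `N` then all `Ext(X, N)` vanish. -/
lemma of_bijective_smul {r : R} (hX : ∀ x : X, r • x = 0)
    (hN : Function.Bijective (fun y : N => r • y)) (n : ℕ) : ExtVan R n X N := by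
  refine subsingleton_of_forall_eq 0 fun x => ?_
  let e : N ≃ₗ[R] N := LinearEquiv.ofBijective (LinearMap.lsmul R N r) hN
  have h1 : (r • 𝟙 (ModuleCat.of R X) : _ ⟶ _) = 0 := by ext x; exact hX x
  have h2 : e.toModuleIso.hom = r • 𝟙 (ModuleCat.of R N) := by ext y; rfl
  have h3 : x.comp (Ext.mk₀ e.toModuleIso.hom) (add_zero n) = 0 := by
    rw [h2, Ext.mk₀_smul, Ext.comp_smul, Ext.comp_mk₀_id, ← x.mk₀_id_comp, ← Ext.smul_comp,
      ← Ext.mk₀_smul, h1, Ext.mk₀_zero, Ext.zero_comp]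
  have : x = x.comp (Ext.mk₀ (e.toModuleIso.hom ≫ e.toModuleIso.inv)) (add_zero n) := by
    rw [Iso.hom_inv_id, Ext.comp_mk₀_id]
  rw [this, ← Ext.mk₀_comp_mk₀, ← Ext.comp_assoc_of_second_deg_zero, h3, Ext.zero_comp]

end ExtVan

end ExtVanishing

section ExtNaturality

/-- The map induced on `Hom(-, Y)` complexes. -/
def linearYonedaObjMap {K L : ChainComplex (ModuleCat.{0} R) ℕ} (φ : K ⟶ L) (Y : ModuleCat.{0} R) :
    L.linearYonedaObj R Y ⟶ K.linearYonedaObj R Y :=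
  (HomologicalComplex.unopFunctor (ModuleCat R) (ComplexShape.down ℕ)).map
    ((((linearYoneda R (ModuleCat.{0} R)).obj Y).rightOp.mapHomologicalComplex _).map φ).op

lemma inv_comp_eq_comp_inv {C : Type*} [Category* C] {A A' B B' : C} (a : A ≅ A') (b : B ≅ B')
    (f : A ⟶ B) (g : A' ⟶ B') (h : f ≫ b.hom = a.hom ≫ g) : a.inv ≫ f = g ≫ b.inv := by
  rw [Iso.inv_comp_eq, ← Category.assoc, Iso.eq_comp_inv, h]

lemma isoExt_naturality {X X' : ModuleCat.{0} R} (f : X ⟶ X') (P : ProjectiveResolution X)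
    (Q : ProjectiveResolution X') (φ : P.complex ⟶ Q.complex)
    (comm : φ.f 0 ≫ Q.π.f 0 = P.π.f 0 ≫ f) (n : ℕ) (Y : ModuleCat.{0} R) :
    ((Ext R (ModuleCat.{0} R) n).map f.op).app Y ≫ (P.isoExt n Y).hom =
      (Q.isoExt n Y).hom ≫ HomologicalComplex.homologyMap (linearYonedaObjMap φ Y) n := by
  have h1 := congrArg Quiver.Hom.unop (ProjectiveResolution.isoLeftDerivedObj_inv_naturality
    f P Q φ comm ((linearYoneda R (ModuleCat.{0} R)).obj Y).rightOp n)
  have h2 := congrArg Quiver.Hom.unop (inv_comp_eq_comp_inv _ _ _ _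
    (HomologicalComplex.homologyOp_hom_naturality (linearYonedaObjMap φ Y) n))
  have h3 : ((Ext R (ModuleCat.{0} R) n).map f.op).app Y =
    ((((linearYoneda R (ModuleCat.{0} R)).obj Y).rightOp.leftDerived n).map f).unop := rfl
  rw [unop_comp, unop_comp] at h1
  have e (X : ModuleCat.{0} R) (P : ProjectiveResolution X) : (P.isoExt n Y).hom =
    (P.isoLeftDerivedObj ((linearYoneda R (ModuleCat.{0} R)).obj Y).rightOp n).inv.unop ≫
      ((P.complex.linearYonedaObj R Y).homologyOp n).inv.unop := rfl
  rw [h3, e, e]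
  refine (Category.assoc _ _ _).symm.trans ?_
  refine (congrArg (· ≫ _) h1).trans ?_
  refine (Category.assoc _ _ _).trans ?_
  refine Eq.trans ?_ (Category.assoc _ _ _).symm
  exact congrArg (_ ≫ ·) h2

lemma homologyπ_eq_zero_iff (K : CochainComplex (ModuleCat.{0} R) ℕ) (n : ℕ)
    (z : K.cycles (n + 1)) :
    (K.homologyπ (n + 1)).hom z = 0 ↔
      ∃ w : K.X n, (K.d n (n + 1)).hom w = (K.iCycles (n + 1)).hom z := by
  have hi : Function.Injective (K.iCycles (n + 1)).hom :=
    (ModuleCat.mono_iff_injective _).1 inferInstance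
  have hex := ShortComplex.exact_of_g_is_cokernel
    (ShortComplex.mk _ _ (K.toCycles_comp_homologyπ n (n + 1)))
    (K.homologyIsCokernel n (n + 1) (by simp))
  rw [ShortComplex.moduleCat_exact_iff] at hex
  constructor
  · intro h
    obtain ⟨w, hw⟩ := hex z h
    refine ⟨w, ?_⟩
    rw [← K.toCycles_i n (n + 1), ModuleCat.comp_apply]
    exact congrArg _ hw
  · rintro ⟨w, hw⟩
    rw [← K.toCycles_i n (n + 1), ModuleCat.comp_apply] at hw
    rw [← hi hw]
    exact congrArg (fun g => g.hom w) (K.toCycles_comp_homologyπ n (n + 1))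

/-- Injectivity of precomposition transfers from `Abelian.Ext` to `Ext`. -/
lemma injective_ext_map_app {X X' : ModuleCat.{0} R} (f : X ⟶ X') (n : ℕ) (Y : ModuleCat.{0} R)
    (h : Function.Injective ((Abelian.Ext.mk₀ f).precomp Y (zero_add (n + 1)))) :
    Function.Injective (((Ext R (ModuleCat.{0} R) (n + 1)).map f.op).app Y).hom := by
  let P := ProjectiveResolution.of X
  let Q := ProjectiveResolution.of X'
  let φ := ProjectiveResolution.lift f P Q
  have comm : φ.f 0 ≫ Q.π.f 0 = P.π.f 0 ≫ f := by
    exact (congrArg (fun g => HomologicalComplex.Hom.f g 0)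
      (ProjectiveResolution.lift_commutes f P Q)).trans (by simp)
  have nat := isoExt_naturality f P Q φ comm (n + 1) Y
  rw [injective_iff_map_eq_zero]
  intro x hx
  let K := Q.complex.linearYonedaObj R Y
  let K' := P.complex.linearYonedaObj R Y
  let y : K.homology (n + 1) := (Q.isoExt (n + 1) Y).hom x
  suffices hy : y = 0 by
    have := congrArg (Q.isoExt (n + 1) Y).inv.hom hy
    simpa [y] using this
  have hy : (HomologicalComplex.homologyMap (linearYonedaObjMap φ Y) (n + 1)).hom y = 0 := by
    have := congrArg (fun g => g.hom x) nat
    simp only [ModuleCat.hom_comp, LinearMap.comp_apply] at this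
    rw [hx, map_zero] at this
    exact this.symm
  obtain ⟨z, hz⟩ := (ModuleCat.epi_iff_surjective (K.homologyπ (n + 1))).1 inferInstance y
  have hz0 : (K.homologyπ (n + 1)).hom z = y := hz
  rw [← hz0, ← LinearMap.comp_apply, ← ModuleCat.hom_comp,
    HomologicalComplex.homologyπ_naturality, ModuleCat.comp_apply] at hy
  obtain ⟨w, hw⟩ := (homologyπ_eq_zero_iff K' n _).1 hy
  rw [← ModuleCat.comp_apply, HomologicalComplex.cyclesMap_i] at hw
  let u : Q.complex.X (n + 1) ⟶ Y := (K.iCycles (n + 1)).hom z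
  have hw' : P.complex.d (n + 1) n ≫ (show P.complex.X n ⟶ Y from w) = φ.f (n + 1) ≫ u := hw
  have hu : Q.complex.d (n + 2) (n + 1) ≫ u = 0 :=
    congrArg (fun g => g.hom z) (K.iCycles_d (n + 1) (n + 2))
  have key : Q.extMk u (n + 2) rfl hu = 0 := by
    apply h
    rw [map_zero]
    refine (Q.mk₀_comp_extMk u (n + 2) rfl hu (R' := P) (g := f) ⟨φ, ?_⟩).trans ?_
    · simpa using comm
    · rw [P.extMk_eq_zero_iff _ _ _ _ n rfl]
      exact ⟨_, hw'⟩
  obtain ⟨g, hg⟩ := (Q.extMk_eq_zero_iff _ _ _ _ n rfl).1 key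
  rw [← hz0, homologyπ_eq_zero_iff]
  exact ⟨g, hg⟩

end ExtNaturality

section LocalCohomology

lemma ExtVan.of_pow_smul_eq_zero [IsNoetherianRing R] [IsLocalRing R] {M : Type} [AddCommGroup M]
    [Module R M] {i : ℕ} (h : ExtVan R i κ M) (t : ℕ) (N : Type) [AddCommGroup N] [Module R N]
    [hN : Module.Finite R N] (ht : ∀ r ∈ 𝔪 ^ t, ∀ x : N, r • x = 0) : ExtVan R i N M := by
  induction hN using IsNoetherianRing.induction_on_isQuotientEquivQuotientPrime with
  | subsingleton N => exact ExtVan.of_subsingleton_left i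
  | quotient N p e =>
    have hp : 𝔪 ^ t ≤ p.1 := by
      intro r hr
      have := ht r hr (e.symm (Submodule.Quotient.mk 1))
      rw [← map_smul, map_eq_zero_iff _ e.symm.injective, ← Submodule.Quotient.mk_smul,
        Submodule.Quotient.mk_eq_zero] at this
      simpa using this
    have hp' : p.1 = 𝔪 := ((IsLocalRing.maximalIdeal.isMaximal R).eq_of_le p.2.ne_top
      (p.2.le_of_pow_le hp)).symm
    exact (h : ExtVan R i (R ⧸ 𝔪) M).congr_left
      ((Submodule.quotEquivOfEq _ _ hp'.symm).trans e.symm)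
  | exact N₁ N₂ N₃ f g hf hg hfg h₁ h₃ =>
    refine ExtVan.contra_mid hf hfg hg (h₁ fun r hr x => hf ?_) (h₃ fun r hr x => ?_)
    · rw [map_smul, map_zero, ht r hr]
    · obtain ⟨y, rfl⟩ := hg x
      rw [← map_smul, ht r hr, map_zero]

lemma exists_map_eq_zero_of_subsingleton_localCohomology (J : Ideal R) (i : ℕ) (M : ModuleCat.{0} R)
    (h : Subsingleton ((localCohomology J i).obj M)) (s : ℕ)
    (x : ((Ext R (ModuleCat.{0} R) i).obj (op (ModuleCat.of R (R ⧸ J ^ s)))).obj M) :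
    ∃ (t : ℕ) (hst : J ^ t ≤ Submodule.comap LinearMap.id (J ^ s)), (((Ext R (ModuleCat.{0} R) i).map
      (ModuleCat.ofHom (Submodule.mapQ (J ^ t) (J ^ s) LinearMap.id hst)).op).app M).hom x = 0 := by
  let F := localCohomology.diagram (localCohomology.idealPowersDiagram J) i
  let G := F ⋙ (evaluation _ _).obj M
  have e : (localCohomology J i).obj M ≅ Limits.colimit G :=
    Limits.colimitObjIsoColimitCompEvaluation F M
  have : Subsingleton (Limits.colimit G : ModuleCat R) := e.toLinearEquiv.symm.toEquiv.subsingleton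
  obtain ⟨k, f, g, hk⟩ := Limits.Concrete.colimit_exists_of_rep_eq G (i := op (op s))
    (j := op (op s)) x 0 (Subsingleton.elim _ _)
  rw [map_zero] at hk
  exact ⟨k.unop.unop, ((localCohomology.idealPowersDiagram J).map f.unop).down.down, hk⟩

/-- If `Ext^i(k, M) = 0` and `H^{i+1}_𝔪(M) = 0` then `Ext^{i+1}(k, M) = 0`. -/
lemma ExtVan.succ_of_localCohomology [IsNoetherianRing R] [IsLocalRing R] {M : Type}
    [AddCommGroup M] [Module R M] {i : ℕ} (h : ExtVan R i κ M)
    (hl : Subsingleton ((localCohomology 𝔪 (i + 1)).obj (ModuleCat.of R M))) :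
    ExtVan R (i + 1) κ M := by
  have key : ExtVan R (i + 1) (R ⧸ 𝔪 ^ 1) M := by
    refine (subsingleton_extModule_iff (i + 1) _ _).1 (subsingleton_of_forall_eq 0 fun x => ?_)
    obtain ⟨t, hst, hx⟩ := exists_map_eq_zero_of_subsingleton_localCohomology _ _ _ hl 1 x
    set g := Submodule.mapQ (𝔪 ^ t) (𝔪 ^ 1) LinearMap.id hst with hg
    have hgs : Function.Surjective g := by
      intro y
      obtain ⟨y, rfl⟩ := Submodule.Quotient.mk_surjective _ y
      exact ⟨Submodule.Quotient.mk y, rfl⟩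
    have hK : ExtVan R i (LinearMap.ker g) M := by
      refine h.of_pow_smul_eq_zero t _ ?_
      rintro r hr ⟨y, hy⟩
      obtain ⟨y, rfl⟩ := Submodule.Quotient.mk_surjective _ y
      ext
      change Submodule.Quotient.mk (r • y) = 0
      rw [Submodule.Quotient.mk_eq_zero]
      exact Ideal.mul_mem_right _ _ hr
    have inj := ExtVan.contra_injective (LinearMap.ker g).injective_subtype
      g.exact_subtype_ker_map hgs hK
    exact injective_ext_map_app _ _ _ inj (hx.trans (map_zero _).symm)
  exact key.congr_left (Submodule.quotEquivOfEq _ _ (pow_one _))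

end LocalCohomology

section HomExact

variable {A B C E : Type} [AddCommGroup A] [Module R A] [AddCommGroup B] [Module R B]
    [AddCommGroup C] [Module R C] [AddCommGroup E] [Module R E]
    {N₁ N₂ N₃ : Type}
    [AddCommGroup N₁] [Module R N₁] [AddCommGroup N₂] [Module R N₂] [AddCommGroup N₃] [Module R N₃]

lemma exists_lift_of_exact {f : N₁ →ₗ[R] N₂} {g : N₂ →ₗ[R] N₃} (hf : Function.Injective f)
    (hfg : Function.Exact f g) (u : A →ₗ[R] N₂) (hu : g ∘ₗ u = 0) :
    ∃ v : A →ₗ[R] N₁, f ∘ₗ v = u := by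
  refine ⟨(LinearEquiv.ofInjective f hf).symm.toLinearMap ∘ₗ u.codRestrict _ fun x => ?_, ?_⟩
  · exact (hfg (u x)).1 (LinearMap.congr_fun hu x)
  · ext x
    simp only [LinearMap.comp_apply, LinearEquiv.coe_coe]
    rw [← LinearEquiv.ofInjective_apply f (h := hf), LinearEquiv.apply_symm_apply]
    rfl

variable {a : A →ₗ[R] B} {b : B →ₗ[R] C} {c : C →ₗ[R] E}
  {f : N₁ →ₗ[R] N₂} {g : N₂ →ₗ[R] N₃}

namespace HomExact

lemma left [Module.Projective R E] (hcb : c ∘ₗ b = 0) (hf : Function.Injective f)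
    (hfg : Function.Exact f g) (hg : Function.Surjective g)
    (h2 : HomExact a b N₂) (h3 : HomExact b c N₃) : HomExact a b N₁ := by
  intro u hu
  obtain ⟨w, hw⟩ := h2 (f ∘ₗ u) (by rw [LinearMap.comp_assoc, hu, LinearMap.comp_zero])
  obtain ⟨h, hh⟩ := h3 (g ∘ₗ w) (by
    rw [LinearMap.comp_assoc, hw, ← LinearMap.comp_assoc, hfg.linearMap_comp_eq_zero,
      LinearMap.zero_comp])
  obtain ⟨h', rfl⟩ := Module.projective_lifting_property g h hg
  obtain ⟨v, hv⟩ := exists_lift_of_exact hf hfg (w - h' ∘ₗ c) (by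
    rw [LinearMap.comp_sub, ← LinearMap.comp_assoc, hh, sub_self])
  refine ⟨v, ?_⟩
  rw [← LinearMap.cancel_left hf, ← LinearMap.comp_assoc, hv, LinearMap.sub_comp, hw,
    LinearMap.comp_assoc, hcb, LinearMap.comp_zero, sub_zero]

lemma right [Module.Projective R C] (hba : b ∘ₗ a = 0) (hf : Function.Injective f)
    (hfg : Function.Exact f g) (hg : Function.Surjective g)
    (h1 : HomExact a b N₁) (h2 : HomExact b c N₂) : HomExact b c N₃ := by
  intro u hu
  obtain ⟨u', rfl⟩ := Module.projective_lifting_property g u hg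
  obtain ⟨w, hw⟩ := exists_lift_of_exact hf hfg (u' ∘ₗ b) (by rw [← LinearMap.comp_assoc, hu])
  obtain ⟨v, rfl⟩ := h1 w (by
    rw [← LinearMap.cancel_left hf, ← LinearMap.comp_assoc, hw, LinearMap.comp_assoc, hba]
    simp)
  obtain ⟨e, he⟩ := h2 (u' - f ∘ₗ v) (by
    rw [LinearMap.sub_comp, LinearMap.comp_assoc, hw, sub_self])
  refine ⟨g ∘ₗ e, ?_⟩
  rw [LinearMap.comp_assoc, he, LinearMap.comp_sub, ← LinearMap.comp_assoc v f g,
    hfg.linearMap_comp_eq_zero, LinearMap.zero_comp, sub_zero]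

lemma mid [Module.Projective R C] (hba : b ∘ₗ a = 0) (hf : Function.Injective f)
    (hfg : Function.Exact f g) (hg : Function.Surjective g)
    (h1 : HomExact a b N₁) (h3 : HomExact a b N₃) : HomExact a b N₂ := by
  intro u hu
  obtain ⟨w, hw⟩ := h3 (g ∘ₗ u) (by rw [LinearMap.comp_assoc, hu, LinearMap.comp_zero])
  obtain ⟨w', rfl⟩ := Module.projective_lifting_property g w hg
  obtain ⟨v, hv⟩ := exists_lift_of_exact hf hfg (u - w' ∘ₗ b) (by
    rw [LinearMap.comp_sub, ← LinearMap.comp_assoc, hw, sub_self])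
  obtain ⟨e, rfl⟩ := h1 v (by
    rw [← LinearMap.cancel_left hf, ← LinearMap.comp_assoc, hv, LinearMap.sub_comp, hu,
      LinearMap.comp_assoc, hba]
    simp)
  refine ⟨f ∘ₗ e + w', ?_⟩
  rw [LinearMap.add_comp, LinearMap.comp_assoc, hv, sub_add_cancel]

lemma congr (e : N₁ ≃ₗ[R] N₂) (h : HomExact a b N₁) : HomExact a b N₂ := by
  intro u hu
  obtain ⟨v, hv⟩ := h (e.symm.toLinearMap ∘ₗ u) (by
    rw [LinearMap.comp_assoc, hu, LinearMap.comp_zero])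
  refine ⟨e.toLinearMap ∘ₗ v, ?_⟩
  rw [LinearMap.comp_assoc, hv]
  ext; simp

lemma prod (h1 : HomExact a b N₁) (h2 : HomExact a b N₂) : HomExact a b (N₁ × N₂) := by
  intro u hu
  obtain ⟨v, hv⟩ := h1 (LinearMap.fst R N₁ N₂ ∘ₗ u) (by
    rw [LinearMap.comp_assoc, hu, LinearMap.comp_zero])
  obtain ⟨w, hw⟩ := h2 (LinearMap.snd R N₁ N₂ ∘ₗ u) (by
    rw [LinearMap.comp_assoc, hu, LinearMap.comp_zero])
  refine ⟨v.prod w, ?_⟩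
  ext x
  · exact LinearMap.congr_fun hv x
  · exact LinearMap.congr_fun hw x

lemma of_subsingleton [Subsingleton N₁] : HomExact a b N₁ :=
  fun _ _ => ⟨0, by ext; exact Subsingleton.elim _ _⟩

end HomExact

end HomExact

section Torsion

variable [IsLocalRing R]

/-- Every element is killed by a power of the maximal ideal. -/
def IsMaxTorsion (R : Type) [CommRing R] [IsLocalRing R] (N : Type) [AddCommGroup N]
    [Module R N] : Prop :=
  ∀ x : N, ∃ t : ℕ, ∀ r ∈ IsLocalRing.maximalIdeal R ^ t, r • x = 0

/-- The submodule of elements killed by a power of the maximal ideal. -/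
def maxTorsion (R : Type) [CommRing R] [IsLocalRing R] (N : Type) [AddCommGroup N]
    [Module R N] : Submodule R N where
  carrier := {x | ∃ t : ℕ, ∀ r ∈ IsLocalRing.maximalIdeal R ^ t, r • x = 0}
  zero_mem' := ⟨0, fun r _ => smul_zero r⟩
  add_mem' := by
    rintro x y ⟨s, hs⟩ ⟨t, ht⟩
    refine ⟨s + t, fun r hr => ?_⟩
    rw [smul_add, hs r (Ideal.pow_le_pow_right (Nat.le_add_right s t) hr),
      ht r (Ideal.pow_le_pow_right (Nat.le_add_left t s) hr), add_zero]
  smul_mem' := by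
    rintro c x ⟨s, hs⟩
    exact ⟨s, fun r hr => by rw [smul_comm, hs r hr, smul_zero]⟩

variable {N : Type} [AddCommGroup N] [Module R N]

lemma isMaxTorsion_maxTorsion : IsMaxTorsion R (maxTorsion R N) := by
  rintro ⟨x, t, ht⟩
  exact ⟨t, fun r hr => Subtype.ext (ht r hr)⟩

lemma IsMaxTorsion.exists_of_finite (hN : IsMaxTorsion R N) {A : Type} [AddCommGroup A]
    [Module R A] [Module.Finite R A] (f : A →ₗ[R] N) : ∃ t : ℕ, ∀ r ∈ 𝔪 ^ t, ∀ a, r • f a = 0 := by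
  obtain ⟨s, hs⟩ := Module.Finite.fg_top (R := R) (M := A)
  choose t ht using hN
  refine ⟨s.sup (fun x => t (f x)), fun r hr a => ?_⟩
  have : a ∈ LinearMap.ker (r • f) := by
    have h : Submodule.span R (s : Set A) ≤ LinearMap.ker (r • f) := by
      rw [Submodule.span_le]
      intro x hx
      exact ht (f x) r (Ideal.pow_le_pow_right (Finset.le_sup (f := fun x => t (f x)) hx) hr)
    exact h (hs ▸ Submodule.mem_top)
  exact this

lemma exists_hom_of_socle (x : N) (hx : ∀ r ∈ 𝔪, r • x = 0) :
    ∃ f : κ →ₗ[R] N, f 1 = x := by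
  let f : (R ⧸ 𝔪) →ₗ[R] N := Submodule.liftQ 𝔪 (LinearMap.toSpanSingleton R N x)
    (fun r hr => by simpa using hx r hr)
  refine ⟨f, ?_⟩
  have : f (Submodule.Quotient.mk 1) = x := by
    rw [Submodule.liftQ_apply]
    simp
  exact this

lemma smul_residueField_eq_zero {r : R} (hr : r ∈ 𝔪) (y : κ) : r • y = 0 := by
  obtain ⟨s, rfl⟩ := IsLocalRing.residue_surjective y
  rw [Algebra.smul_def, IsLocalRing.ResidueField.algebraMap_eq,
    (IsLocalRing.residue_eq_zero_iff r).2 hr, zero_mul]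

lemma hom_residueField_eq_zero_iff : ExtVan R 0 κ N ↔ ∀ x : N, (∀ r ∈ 𝔪, r • x = 0) → x = 0 := by
  rw [ExtVan.zero_iff]
  constructor
  · intro h x hx
    obtain ⟨f, rfl⟩ := exists_hom_of_socle x hx
    rw [h f]; rfl
  · intro h f
    refine LinearMap.ext fun y => ?_
    apply h
    intro s hs
    rw [← map_smul, smul_residueField_eq_zero hs, map_zero]

variable [IsNoetherianRing R]

lemma ExtVan.zero_quotient_maxTorsion : ExtVan R 0 κ (N ⧸ maxTorsion R N) := by
  rw [hom_residueField_eq_zero_iff]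
  intro x hx
  obtain ⟨x, rfl⟩ := Submodule.Quotient.mk_surjective _ x
  rw [Submodule.Quotient.mk_eq_zero]
  let f : 𝔪 →ₗ[R] maxTorsion R N :=
    ((LinearMap.toSpanSingleton R N x) ∘ₗ (𝔪).subtype).codRestrict _ (fun r => by
      have := hx r r.2
      rwa [← Submodule.Quotient.mk_smul, Submodule.Quotient.mk_eq_zero] at this)
  obtain ⟨t, ht⟩ := isMaxTorsion_maxTorsion.exists_of_finite f
  refine ⟨t + 1, fun r hr => ?_⟩
  rw [pow_succ] at hr
  refine Submodule.mul_induction_on hr (fun a ha b hb => ?_) (fun a b ha hb => ?_)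
  · rw [mul_smul]
    exact congrArg Subtype.val (ht a ha ⟨b, hb⟩)
  · rw [add_smul, ha, hb, add_zero]

lemma IsMaxTorsion.injective (hN : IsMaxTorsion R N) (h : ExtVan R 1 κ N) :
    Module.Injective R N := by
  apply Module.Baer.injective
  intro I f
  obtain ⟨t, ht⟩ := hN.exists_of_finite f
  obtain ⟨c, hc⟩ := Ideal.exists_pow_inf_eq_pow_smul 𝔪 I
  have hle : 𝔪 ^ (t + c) ⊓ I ≤ 𝔪 ^ t • I := by
    have := hc (t + c) (Nat.le_add_left _ _)
    rw [Nat.add_sub_cancel] at this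
    simp only [smul_eq_mul, Ideal.mul_top] at this
    rw [this, smul_eq_mul]
    exact Ideal.mul_mono_right inf_le_right
  have hker : ∀ (x : R) (hx : x ∈ I), x ∈ 𝔪 ^ (t + c) → f ⟨x, hx⟩ = 0 := by
    intro x hx hx'
    have : ∃ hy : x ∈ I, f ⟨x, hy⟩ = 0 := by
      refine Submodule.smul_induction_on (p := fun y => ∃ hy : y ∈ I, f ⟨y, hy⟩ = 0)
        (hle ⟨hx', hx⟩) (fun r hr z hz => ?_) (fun a b ha hb => ?_)
      · have := ht r hr ⟨z, hz⟩
        rw [← map_smul] at this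
        exact ⟨I.mul_mem_left _ hz, this⟩
      · obtain ⟨ha', ha⟩ := ha
        obtain ⟨hb', hb⟩ := hb
        refine ⟨I.add_mem ha' hb', ?_⟩
        have := map_add f ⟨a, ha'⟩ ⟨b, hb'⟩
        rw [ha, hb, add_zero] at this
        exact this
    exact this.2
  let F : R →ₗ.[R] N := LinearPMap.sup ⟨I, f⟩ ⟨𝔪 ^ (t + c), 0⟩ (by
    rintro ⟨x, hx⟩ ⟨y, hy⟩ (rfl : x = y)
    exact hker x hx hy)
  have hE : ExtVan R 1 (R ⧸ F.domain) N := by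
    refine h.of_pow_smul_eq_zero (t + c) _ fun r hr x => ?_
    obtain ⟨x, rfl⟩ := Submodule.Quotient.mk_surjective _ x
    rw [← Submodule.Quotient.mk_smul, Submodule.Quotient.mk_eq_zero]
    exact Submodule.mem_sup_right (Ideal.mul_mem_right _ _ hr)
  obtain ⟨v, hv⟩ := ExtVan.exists_extend (f := F.domain.subtype) (g := F.domain.mkQ)
    F.domain.injective_subtype (LinearMap.exact_subtype_mkQ _) (Submodule.mkQ_surjective _) hE
    F.toFun
  refine ⟨v, fun x hx => ?_⟩
  have h1 := LinearMap.congr_fun hv ⟨x, Submodule.mem_sup_left hx⟩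
  refine h1.trans ?_
  exact ((LinearPMap.left_le_sup _ _ _).2 (x := ⟨x, hx⟩) (y := ⟨x, Submodule.mem_sup_left hx⟩)
    rfl).symm

end Torsion

section Koszul

/-- The formal properties of the dual `P^*` of a resolution `P` of the residue field by finite
free modules, preceded by a zero term. -/
structure DualComplex (R : Type) [CommRing R] [IsLocalRing R] where
  /-- The terms, where `G (j + 1)` is the dual of `P j`. -/
  G : ℕ → Type
  [addCommGroup : ∀ j, AddCommGroup (G j)]
  [module : ∀ j, Module R (G j)]
  [projective : ∀ j, Module.Projective R (G j)]
  [subsingleton_zero : Subsingleton (G 0)]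
  /-- The differentials. -/
  δ : ∀ j, G j →ₗ[R] G (j + 1)
  comp_eq_zero : ∀ j, δ (j + 1) ∘ₗ δ j = 0
  exists_homotopy : ∀ r ∈ IsLocalRing.maximalIdeal R, ∀ j,
    ∃ (s : G (j + 1) →ₗ[R] G j) (s' : G (j + 2) →ₗ[R] G (j + 1)),
      r • LinearMap.id = s' ∘ₗ δ (j + 1) + δ j ∘ₗ s

namespace DualComplex

variable [IsLocalRing R]

attribute [instance] addCommGroup module projective subsingleton_zero

variable (D : DualComplex R)

/-- The vanishing of the `j`-th homology of `Hom(P^*, N) = P ⊗ N`, i.e. of `Tor_j(k, N)`. -/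
def TorVan (j : ℕ) (N : Type) [AddCommGroup N] [Module R N] : Prop :=
  HomExact (D.δ j) (D.δ (j + 1)) N

/-- The vanishing of the `j`-th cohomology of `P^*`, i.e. of `Ext^j(k, R)`. -/
def SelfVan (j : ℕ) : Prop :=
  LinearMap.ker (D.δ (j + 1)) ≤ LinearMap.range (D.δ j)

variable {D} {N : Type} [AddCommGroup N] [Module R N]

lemma torVan_of_injective [Module.Injective R N] {j : ℕ} (hj : D.SelfVan j) : D.TorVan j N := by
  intro f hf
  have hker : LinearMap.ker (D.δ (j + 1)) ≤ LinearMap.ker f := by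
    refine hj.trans ?_
    rintro _ ⟨x, rfl⟩
    exact LinearMap.congr_fun hf x
  obtain ⟨g, hg⟩ := Module.Injective.out
    ((LinearMap.ker (D.δ (j + 1))).liftQ (D.δ (j + 1)) le_rfl)
    (LinearMap.ker_eq_bot.1 (Submodule.ker_liftQ_eq_bot _ _ _ le_rfl))
    ((LinearMap.ker (D.δ (j + 1))).liftQ f hker)
  refine ⟨g, LinearMap.ext fun x => ?_⟩
  exact hg (Submodule.Quotient.mk x)

lemma torVan_of_bijective_smul {r : R} (hr : r ∈ 𝔪)
    (hN : Function.Bijective (fun y : N => r • y)) (j : ℕ) : D.TorVan j N := by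
  intro f hf
  obtain ⟨s, s', hs⟩ := D.exists_homotopy r hr j
  let e : N ≃ₗ[R] N := LinearEquiv.ofBijective (LinearMap.lsmul R N r) hN
  refine ⟨e.symm.toLinearMap ∘ₗ f ∘ₗ s', LinearMap.ext fun x => ?_⟩
  apply e.injective
  have h1 := congrArg f (LinearMap.congr_fun hs x)
  have h2 := LinearMap.congr_fun hf (s x)
  simp only [LinearMap.comp_apply, LinearMap.add_apply, LinearMap.smul_apply, map_add,
    map_smul, LinearMap.id_apply, LinearMap.zero_apply] at h1 h2
  rw [h2, add_zero] at h1
  simp only [LinearMap.comp_apply, LinearEquiv.coe_coe, LinearEquiv.apply_symm_apply]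
  rw [← h1]
  rfl

lemma smul_mem_range {j : ℕ} {r : R} (hr : r ∈ 𝔪) {v : D.G (j + 1)} (hv : D.δ (j + 1) v = 0) :
    r • v ∈ LinearMap.range (D.δ j) := by
  obtain ⟨s, s', hs⟩ := D.exists_homotopy r hr j
  refine ⟨s v, ?_⟩
  have h1 := LinearMap.congr_fun hs v
  simp only [LinearMap.comp_apply, LinearMap.add_apply, LinearMap.smul_apply, hv, map_zero,
    LinearMap.id_apply, zero_add] at h1
  exact h1.symm

lemma exists_hom_apply_eq [Module.Injective R N] {j : ℕ} {v : D.G (j + 1)}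
    (hv : D.δ (j + 1) v = 0) (hv' : v ∉ LinearMap.range (D.δ j)) {c : N}
    (hc : ∀ r ∈ 𝔪, r • c = 0) : ∃ f : D.G (j + 1) →ₗ[R] N, f ∘ₗ D.δ j = 0 ∧ f v = c := by
  obtain ⟨u, hu⟩ := exists_hom_of_socle (R := R)
    (Submodule.Quotient.mk (p := LinearMap.range (D.δ j)) v)
    (fun r hr => by
      rw [← Submodule.Quotient.mk_smul, Submodule.Quotient.mk_eq_zero]
      exact smul_mem_range hr hv)
  obtain ⟨w, hw⟩ := exists_hom_of_socle c hc
  have hinj : Function.Injective u := by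
    rw [injective_iff_map_eq_zero]
    intro y hy
    by_contra hne
    apply hv'
    rw [← Submodule.Quotient.mk_eq_zero, ← hu]
    obtain ⟨r, hr⟩ := IsLocalRing.residue_surjective y⁻¹
    have : r • y = 1 := by
      rw [Algebra.smul_def, IsLocalRing.ResidueField.algebraMap_eq, hr, inv_mul_cancel₀ hne]
    rw [← this, map_smul, hy, smul_zero]
  obtain ⟨f, hf⟩ := Module.Injective.out u hinj w
  refine ⟨f ∘ₗ Submodule.mkQ _, ?_, ?_⟩
  · rw [LinearMap.comp_assoc, LinearMap.range_mkQ_comp, LinearMap.comp_zero]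
  · have := hf 1
    rw [hu, hw] at this
    exact this

section Depth

variable {d : ℕ} (hlt : ∀ j < d, D.SelfVan j) (hd : ¬ D.SelfVan d)

variable {M I C : Type} [AddCommGroup M] [Module R M] [AddCommGroup I] [Module R I]
  [AddCommGroup C] [Module R C]

variable [IsNoetherianRing R]

lemma injective_maxTorsion (h1 : ExtVan R 1 κ M) : Module.Injective R (maxTorsion R M) := by
  refine isMaxTorsion_maxTorsion.injective (ExtVan.cov_left (Submodule.injective_subtype _)
    (LinearMap.exact_subtype_mkQ _) (Submodule.mkQ_surjective _)
    ExtVan.zero_quotient_maxTorsion h1)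

include hd in
lemma not_torVan_of_not_extVan_zero (h0 : ¬ ExtVan R 0 κ M) (h1 : ExtVan R 1 κ M) :
    ¬ D.TorVan d M := by
  intro hT
  have := injective_maxTorsion h1
  rw [hom_residueField_eq_zero_iff] at h0
  push Not at h0
  obtain ⟨c, hc, hc0⟩ := h0
  obtain ⟨v, hv, hv'⟩ := SetLike.not_le_iff_exists.1 hd
  obtain ⟨f, hf, hfv⟩ := exists_hom_apply_eq (N := maxTorsion R M) hv hv'
    (c := ⟨c, 1, fun r hr => hc r (by simpa using hr)⟩) (fun r hr => Subtype.ext (hc r hr))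
  obtain ⟨g, hg⟩ := hT ((maxTorsion R M).subtype ∘ₗ f) (by
    rw [LinearMap.comp_assoc, hf, LinearMap.comp_zero])
  apply hc0
  have := LinearMap.congr_fun hg v
  simp only [LinearMap.comp_apply, hfv] at this
  rw [LinearMap.mem_ker.1 hv, map_zero] at this
  exact this.symm

include hlt in
lemma torVan_of_extVan_pos
    (L : ∀ (N : Type) [AddCommGroup N] [Module R N], (∀ i, ExtVan R i κ N) → ∀ j, D.TorVan j N)
    (h : ∀ i, 0 < i → ExtVan R i κ M) {j : ℕ} (hj : j < d) : D.TorVan j M := by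
  have := injective_maxTorsion (h 1 one_pos)
  refine HomExact.mid (D.comp_eq_zero j) (Submodule.injective_subtype (maxTorsion R M))
    (LinearMap.exact_subtype_mkQ _) (Submodule.mkQ_surjective _)
    (torVan_of_injective (hlt j hj)) (L _ (fun i => ?_) j)
  cases i with
  | zero => exact ExtVan.zero_quotient_maxTorsion
  | succ i =>
    exact ExtVan.cov_right (Submodule.injective_subtype _)
      (LinearMap.exact_subtype_mkQ _) (Submodule.mkQ_surjective _) (h _ (Nat.succ_pos _))
      (ExtVan.of_injective _)

variable {f : M →ₗ[R] I} {g : I →ₗ[R] C} (hf : Function.Injective f) (hfg : Function.Exact f g)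
  (hg : Function.Surjective g)

include hd hf hfg hg in
/-- If a socle element of `C` does not lift to the socle of `I`, the class it defines survives. -/
lemma exists_not_homExact [Module.Injective R I]
    (h1 : ¬ ExtVan R 1 κ M) (h2 : ExtVan R 2 κ M) :
    ∃ u : D.G d →ₗ[R] M, (∀ j, (h : j + 1 = d) → u ∘ₗ (h ▸ D.δ j) = 0) ∧
      ¬ ∃ w : D.G (d + 1) →ₗ[R] M, w ∘ₗ D.δ d = u := by
  have hC1 : ExtVan R 1 κ C := ExtVan.cov_right hf hfg hg (ExtVan.of_injective _) h2
  have := injective_maxTorsion hC1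
  have hex : ∃ c : C, (∀ r ∈ 𝔪, r • c = 0) ∧ ∀ x : I, (∀ r ∈ 𝔪, r • x = 0) → g x ≠ c := by
    by_contra hcon
    push Not at hcon
    refine h1 (ExtVan.one_of_exists_lift hf hfg hg (ExtVan.of_injective _) fun u => ?_)
    obtain ⟨x, hx, hxc⟩ := hcon (u 1) (fun r hr => by
      rw [← map_smul, smul_residueField_eq_zero hr, map_zero])
    obtain ⟨w, rfl⟩ := exists_hom_of_socle x hx
    refine ⟨w, LinearMap.ext fun y => ?_⟩
    obtain ⟨r, rfl⟩ := IsLocalRing.residue_surjective y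
    have : IsLocalRing.residue R r = r • (1 : κ) := by
      rw [Algebra.smul_def, IsLocalRing.ResidueField.algebraMap_eq, mul_one]
    rw [this, map_smul, map_smul, ← hxc, LinearMap.comp_apply]
  obtain ⟨c, hc, hcI⟩ := hex
  obtain ⟨v, hv, hv'⟩ := SetLike.not_le_iff_exists.1 hd
  obtain ⟨q, hq, hqv⟩ := exists_hom_apply_eq (N := maxTorsion R C) hv hv'
    (c := ⟨c, 1, fun r hr => hc r (by simpa using hr)⟩) (fun r hr => Subtype.ext (hc r hr))
  obtain ⟨p, hp⟩ := Module.projective_lifting_property g ((maxTorsion R C).subtype ∘ₗ q) hg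
  obtain ⟨u, hu⟩ := exists_lift_of_exact hf hfg (p ∘ₗ D.δ d) (by
    rw [← LinearMap.comp_assoc, hp, LinearMap.comp_assoc, hq, LinearMap.comp_zero])
  refine ⟨u, ?_, ?_⟩
  · rintro j rfl
    rw [← LinearMap.cancel_left hf, ← LinearMap.comp_assoc, hu, LinearMap.comp_assoc,
      D.comp_eq_zero, LinearMap.comp_zero, LinearMap.comp_zero]
  · rintro ⟨w, rfl⟩
    refine hcI ((p - f ∘ₗ w) v) (fun r hr => ?_) ?_
    · obtain ⟨y, hy⟩ := smul_mem_range hr (LinearMap.mem_ker.1 hv)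
      rw [← map_smul, ← hy]
      have := LinearMap.congr_fun hu y
      simp only [LinearMap.comp_apply] at this
      simp [this]
    · rw [LinearMap.sub_apply, map_sub, LinearMap.comp_apply, hfg.apply_apply_eq_zero, sub_zero]
      have := LinearMap.congr_fun hp v
      simp only [LinearMap.comp_apply, hqv] at this
      exact this

include hlt hd in
theorem torVan_of_extVan
    (L : ∀ (N : Type) [AddCommGroup N] [Module R N], (∀ i, ExtVan R i κ N) → ∀ j, D.TorVan j N)
    (s : ℕ) (M : Type) [AddCommGroup M] [Module R M]
    (hs : ¬ ExtVan R s κ M) (h : ∀ i, s < i → ExtVan R i κ M) :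
    s ≤ d ∧ (∀ j, j + s < d → D.TorVan j M) ∧ ¬ D.TorVan (d - s) M := by
  induction s generalizing M with
  | zero =>
    exact ⟨Nat.zero_le _, fun j hj => torVan_of_extVan_pos hlt L h hj,
      not_torVan_of_not_extVan_zero hd hs (h 1 one_pos)⟩
  | succ s ih =>
    obtain ⟨⟨I, hI, f, hf⟩⟩ := EnoughInjectives.presentation (ModuleCat.of R M)
    have hI' : Module.Injective R I := (Module.injective_iff_injective_object R I).2 hI
    have hfi : Function.Injective f.hom := (ModuleCat.mono_iff_injective _).1 hf
    have hex : Function.Exact f.hom (LinearMap.range f.hom).mkQ :=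
      LinearMap.exact_map_mkQ_range f.hom
    have hsur := Submodule.mkQ_surjective (LinearMap.range f.hom)
    obtain ⟨hle, hvan, hnon⟩ := ih (I ⧸ LinearMap.range f.hom)
      (fun h' => hs (ExtVan.cov_left hfi hex hsur h' (ExtVan.of_injective _)))
      (fun i hi => ExtVan.cov_right hfi hex hsur (by
        obtain ⟨i, rfl⟩ := Nat.exists_eq_add_of_lt hi
        exact ExtVan.of_injective _) (h _ (by omega)))
    have key : s + 1 ≤ d ∧ ¬ D.TorVan (d - (s + 1)) M := by
      cases s with
      | zero =>
        obtain ⟨u, hu, hu'⟩ := exists_not_homExact hd hfi hex hsur hs (h 2 (by omega))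
        cases d with
        | zero =>
          exact absurd ⟨0, by ext x; rw [Subsingleton.elim x 0, map_zero, map_zero]⟩ hu'
        | succ d => exact ⟨by omega, fun hT => hu' (hT u (hu d rfl))⟩
      | succ s =>
        have hj0 : s + 1 ≠ d := by
          rintro rfl
          apply hnon
          rw [Nat.sub_self]
          intro q _
          obtain ⟨p, rfl⟩ := Module.projective_lifting_property _ q hsur
          obtain ⟨w, rfl⟩ := torVan_of_injective (N := I) (hlt 0 (Nat.succ_pos s)) p
            (by ext x; rw [Subsingleton.elim x 0, map_zero, map_zero])
          exact ⟨_ ∘ₗ w, LinearMap.comp_assoc _ _ _⟩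
        obtain ⟨j, rfl⟩ := Nat.exists_eq_add_of_le (show s + 2 ≤ d by omega)
        refine ⟨by omega, fun hT => hnon ?_⟩
        have e1 : s + 2 + j - (s + 1 + 1) = j := by omega
        have e2 : s + 2 + j - (s + 1) = j + 1 := by omega
        rw [e1] at hT
        rw [e2]
        exact HomExact.right (D.comp_eq_zero _) hfi hex hsur hT
          (torVan_of_injective (hlt (j + 1) (by omega)))
    refine ⟨key.1, fun j hj => ?_, key.2⟩
    exact HomExact.left (D.comp_eq_zero _) hfi hex hsur (torVan_of_injective (hlt j (by omega)))
      (hvan (j + 1) (by omega))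

end Depth

end DualComplex

end Koszul

section Cech

namespace DualComplex

variable [IsLocalRing R] {D : DualComplex R}

variable (D) in
/-- All `Ext(k, N)` and all `Tor(k, N)` vanish. -/
def BothVan (N : Type) [AddCommGroup N] [Module R N] : Prop :=
  (∀ i, ExtVan R i κ N) ∧ ∀ j, D.TorVan j N

/-- A bounded complex which begins with `N`, whose other terms have vanishing `Ext` and `Tor`, and
whose cohomology is `x`-power torsion for all `x ∈ S`, such as a Čech complex. -/
structure CechComplex (D : DualComplex R) (N : Type) [AddCommGroup N] [Module R N]
    (S : Set R) where
  /-- The terms. -/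
  X : ℕ → ModuleCat.{0} R
  /-- The differentials. -/
  d : ∀ i, X i →ₗ[R] X (i + 1)
  comp_eq_zero : ∀ i, d (i + 1) ∘ₗ d i = 0
  subsingleton_zero : Subsingleton (X 0)
  /-- The first nonzero term is `N`. -/
  equiv : N ≃ₗ[R] X 1
  bothVan : ∀ i, D.BothVan (X (i + 2))
  bounded : ∃ n, ∀ i, n ≤ i → Subsingleton (X i)
  torsion : ∀ x ∈ S, ∀ i (z : X (i + 1)), d (i + 1) z = 0 →
    ∃ t : ℕ, x ^ t • z ∈ LinearMap.range (d i)

namespace CechComplex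

variable {N : Type} [AddCommGroup N] [Module R N]

/-- The complex with single term `N`. -/
def single : CechComplex D N ∅ where
  X
    | 1 => ModuleCat.of R N
    | _ => ModuleCat.of R PUnit
  d _ := 0
  comp_eq_zero _ := LinearMap.comp_zero _
  subsingleton_zero := inferInstanceAs (Subsingleton PUnit)
  equiv := LinearEquiv.refl R N
  bothVan _ := by
    have : Subsingleton (ModuleCat.of R PUnit) := inferInstanceAs (Subsingleton PUnit)
    exact ⟨fun i => ExtVan.of_subsingleton (N := PUnit) i,
      fun i => HomExact.of_subsingleton (N₁ := PUnit)⟩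
  bounded := ⟨2, fun i hi => by
    obtain ⟨i, rfl⟩ := Nat.exists_eq_add_of_le' hi
    exact inferInstanceAs (Subsingleton PUnit)⟩
  torsion _ h := absurd h (Set.notMem_empty _)

section Insert

variable {S : Set R} (C : CechComplex D N S) (x : R)

/-- The localization of the terms. -/
abbrev Loc (i : ℕ) : Type := LocalizedModule (Submonoid.powers x) (C.X i)

/-- The localization map. -/
abbrev ι (i : ℕ) : C.X i →ₗ[R] C.Loc x i := LocalizedModule.mkLinearMap (Submonoid.powers x) (C.X i)

/-- The localized differential. -/
abbrev dLoc (i : ℕ) : C.Loc x i →ₗ[R] C.Loc x (i + 1) :=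
  IsLocalizedModule.map (Submonoid.powers x) (C.ι x i) (C.ι x (i + 1)) (C.d i)

lemma dLoc_ι (i : ℕ) (a : C.X i) : C.dLoc x i (C.ι x i a) = C.ι x (i + 1) (C.d i a) :=
  IsLocalizedModule.map_apply _ _ _ _ _

lemma exists_pow_smul_eq (i : ℕ) (b : C.Loc x i) : ∃ (t : ℕ) (a : C.X i), x ^ t • b = C.ι x i a := by
  obtain ⟨⟨a, ⟨_, t, rfl⟩⟩, h⟩ := IsLocalizedModule.surj (Submonoid.powers x) (C.ι x i) b
  exact ⟨t, a, h⟩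

lemma exists_pow_smul_eq_zero (i : ℕ) (a : C.X i) (h : C.ι x i a = 0) :
    ∃ t : ℕ, x ^ t • a = 0 := by
  obtain ⟨⟨_, t, rfl⟩, h⟩ := (IsLocalizedModule.eq_zero_iff (Submonoid.powers x) (C.ι x i)).1 h
  exact ⟨t, h⟩

lemma bijective_smul (i : ℕ) : Function.Bijective (fun b : C.Loc x i => x • b) :=
  (Module.End.isUnit_iff _).1
    (IsLocalizedModule.map_units (C.ι x i) ⟨x, Submonoid.mem_powers x⟩)

lemma bothVan_loc (hx : x ∈ 𝔪) (i : ℕ) : D.BothVan (C.Loc x i) :=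
  ⟨fun j => ExtVan.of_bijective_smul (smul_residueField_eq_zero hx) (C.bijective_smul x i) j,
    fun j => torVan_of_bijective_smul hx (C.bijective_smul x i) j⟩

lemma pow_smul_injective (i t : ℕ) : Function.Injective (fun b : C.Loc x i => x ^ t • b) :=
  IsLocalizedModule.smul_injective (C.ι x i) (⟨x ^ t, t, rfl⟩ : Submonoid.powers x)

lemma dLoc_dLoc (i : ℕ) (b : C.Loc x i) : C.dLoc x (i + 1) (C.dLoc x i b) = 0 := by
  obtain ⟨t, a, h⟩ := C.exists_pow_smul_eq x i b
  apply C.pow_smul_injective x _ t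
  have := LinearMap.congr_fun (C.comp_eq_zero i) a
  simp only [LinearMap.comp_apply, LinearMap.zero_apply] at this
  simp only [← map_smul, h, dLoc_ι, this, map_zero, smul_zero]

lemma subsingleton_loc (i : ℕ) (h : Subsingleton (C.X i)) : Subsingleton (C.Loc x i) := by
  refine subsingleton_of_forall_eq 0 fun b => ?_
  obtain ⟨t, a, hb⟩ := C.exists_pow_smul_eq x i b
  apply C.pow_smul_injective x _ t
  simp only [hb, Subsingleton.elim a 0, map_zero, smul_zero]

/-- The terms of the cone of the localization map. -/
def coneX : ℕ → ModuleCat.{0} R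
  | 0 => C.X 0
  | i + 1 => ModuleCat.of R (C.X (i + 1) × C.Loc x i)

/-- The differential of the cone of the localization map. -/
def coneD : ∀ i, C.coneX x i →ₗ[R] C.coneX x (i + 1)
  | 0 => (0 : C.X 0 →ₗ[R] C.X 1 × C.Loc x 0)
  | i + 1 => ((C.d (i + 1) ∘ₗ LinearMap.fst R _ _).prod
      (C.ι x (i + 1) ∘ₗ LinearMap.fst R _ _ - C.dLoc x i ∘ₗ LinearMap.snd R _ _) :
        C.X (i + 1) × C.Loc x i →ₗ[R] C.X (i + 2) × C.Loc x (i + 1))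

lemma d_d (i : ℕ) (a : C.X i) : C.d (i + 1) (C.d i a) = 0 :=
  LinearMap.congr_fun (C.comp_eq_zero i) a

lemma torsion_self (i : ℕ) (a : C.X (i + 1)) (b : C.Loc x i) (h : C.ι x (i + 1) a = C.dLoc x i b) :
    ∃ (t : ℕ) (e : C.X i), C.d i e = x ^ t • a ∧ C.ι x i e = x ^ t • b := by
  obtain ⟨s, b', hb⟩ := C.exists_pow_smul_eq x i b
  obtain ⟨t, ht⟩ := C.exists_pow_smul_eq_zero x (i + 1) (x ^ s • a - C.d i b') (by
    rw [map_sub, map_smul, h, ← map_smul, hb, dLoc_ι, sub_self])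
  refine ⟨t + s, x ^ t • b', ?_, ?_⟩
  · rw [smul_sub, sub_eq_zero] at ht
    rw [map_smul, ← ht, pow_add, mul_smul]
  · rw [map_smul, ← hb, pow_add, mul_smul]

lemma torsion_of_mem {y : R} (hy : y ∈ S) (i : ℕ) (a : C.X (i + 2)) (b : C.Loc x (i + 1))
    (ha : C.d (i + 2) a = 0)
    (h : C.ι x (i + 2) a = C.dLoc x (i + 1) b) :
    ∃ (t : ℕ) (e : C.X (i + 1)) (e' : C.Loc x i), C.d (i + 1) e = y ^ t • a ∧
      C.ι x (i + 1) e - C.dLoc x i e' = y ^ t • b := by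
  obtain ⟨t, e, he⟩ := C.torsion y hy (i + 1) a ha
  have hb' : C.ι x (i + 2) 0 = C.dLoc x (i + 1) (y ^ t • b - C.ι x (i + 1) e) := by
    rw [map_sub, map_smul, ← h, dLoc_ι, he, map_smul, sub_self, map_zero]
  obtain ⟨s, c, hc, hc'⟩ := C.torsion_self x (i + 1) _ _ hb'
  rw [smul_zero] at hc
  obtain ⟨r, e₁, he₁⟩ := C.torsion y hy i c hc
  obtain ⟨e', he'⟩ := (Module.End.isUnit_iff _).1
    (IsLocalizedModule.map_units (C.ι x i) (⟨x ^ s, s, rfl⟩ : Submonoid.powers x)) |>.2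
      (-C.ι x i e₁)
  refine ⟨r + t, y ^ r • e, e', by rw [map_smul, he, pow_add, mul_smul], ?_⟩
  have he' : x ^ s • e' = -C.ι x i e₁ := he'
  apply C.pow_smul_injective x _ s
  have h1 : x ^ s • C.dLoc x i e' = - (y ^ r • C.ι x (i + 1) c) := by
    rw [← map_smul, he', map_neg, dLoc_ι, he₁, map_smul]
  simp only [smul_sub, h1, hc', map_smul, sub_neg_eq_add, pow_add, mul_smul]
  rw [smul_comm (x ^ s) (y ^ r), smul_comm (x ^ s) (y ^ r) (y ^ t • b)]
  abel

/-- The cone of the localization map at `x`. -/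
def insert (hx : x ∈ 𝔪) : CechComplex D N (Insert.insert x S) where
  X := C.coneX x
  d := C.coneD x
  comp_eq_zero
    | 0 => LinearMap.comp_zero _
    | i + 1 => by
      refine LinearMap.ext fun (z : C.X (i + 1) × C.Loc x i) => ?_
      refine Prod.ext (C.d_d _ _) ?_
      change C.ι x (i + 2) (C.d (i + 1) z.1) -
        C.dLoc x (i + 1) (C.ι x (i + 1) z.1 - C.dLoc x i z.2) = 0
      rw [map_sub, dLoc_ι, dLoc_dLoc, sub_zero, sub_self]
  subsingleton_zero := C.subsingleton_zero
  equiv :=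
    have := C.subsingleton_loc x 0 C.subsingleton_zero
    C.equiv.trans (LinearEquiv.ofBijective (LinearMap.inl R (C.X 1) (C.Loc x 0))
      ⟨LinearMap.inl_injective, fun z => ⟨z.1, Prod.ext rfl (Subsingleton.elim _ _)⟩⟩)
  bothVan i :=
    ⟨fun j => ((C.bothVan i).1 j).prod ((C.bothVan_loc x hx (i + 1)).1 j),
      fun j => HomExact.prod ((C.bothVan i).2 j) ((C.bothVan_loc x hx (i + 1)).2 j)⟩
  bounded := by
    obtain ⟨n, hn⟩ := C.bounded
    refine ⟨n + 1, fun i hi => ?_⟩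
    obtain ⟨i, rfl⟩ := Nat.exists_eq_add_of_le' (show 1 ≤ i by omega)
    have := hn (i + 1) (by omega)
    have := C.subsingleton_loc x i (hn i (by omega))
    exact inferInstanceAs (Subsingleton (C.X (i + 1) × C.Loc x i))
  torsion := by
    rintro y hy i ⟨a, b⟩ hz
    have ha : C.d (i + 1) a = 0 := congrArg Prod.fst hz
    have hb : C.ι x (i + 1) a = C.dLoc x i b := sub_eq_zero.1 (congrArg Prod.snd hz)
    cases i with
    | zero =>
      have := C.subsingleton_zero
      have := C.subsingleton_loc x 0 C.subsingleton_zero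
      have : ∃ t : ℕ, y ^ t • a = 0 := by
        rcases hy with rfl | hy
        · obtain ⟨t, e, he, -⟩ := C.torsion_self y 0 a b hb
          exact ⟨t, by rw [← he, Subsingleton.elim e 0, map_zero]⟩
        · obtain ⟨t, e, he⟩ := C.torsion y hy 0 a ha
          exact ⟨t, by rw [← he, Subsingleton.elim e 0, map_zero]⟩
      obtain ⟨t, ht⟩ := this
      exact ⟨t, (0 : C.X 0), Prod.ext ht.symm (Subsingleton.elim (α := C.Loc x 0) _ _)⟩
    | succ i =>
      rcases hy with rfl | hy
      · obtain ⟨t, e, he, he'⟩ := C.torsion_self y (i + 1) a b hb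
        refine ⟨t, ((e, 0) : C.X (i + 1) × C.Loc y i), Prod.ext he ?_⟩
        change C.ι y (i + 1) e - C.dLoc y i 0 = y ^ t • b
        rw [map_zero, sub_zero, he']
      · obtain ⟨t, e, e', he, he'⟩ := C.torsion_of_mem x hy i a b ha hb
        exact ⟨t, ((e, e') : C.X (i + 1) × C.Loc x i), Prod.ext he he'⟩

end Insert

lemma exists_of_finset (s : Finset R) (hs : ∀ x ∈ s, x ∈ 𝔪) :
    Nonempty (CechComplex D N (s : Set R)) := by
  classical
  induction s using Finset.induction_on with
  | empty => rw [Finset.coe_empty]; exact ⟨single⟩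
  | insert x s _ ih =>
    obtain ⟨C⟩ := ih fun y hy => hs y (Finset.mem_insert_of_mem hy)
    rw [Finset.coe_insert]
    exact ⟨C.insert x (hs x (Finset.mem_insert_self _ _))⟩

lemma eq_zero_of_pow {W : Type} [AddCommGroup W] [Module R W] (h : ExtVan R 0 κ W) (t : ℕ) (w : W)
    (hw : ∀ r ∈ 𝔪 ^ t, r • w = 0) : w = 0 := by
  rw [hom_residueField_eq_zero_iff] at h
  induction t generalizing w with
  | zero => simpa using hw 1 (by simp)
  | succ t ih =>
    refine ih w fun r hr => h _ fun a ha => ?_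
    rw [smul_smul]
    exact hw _ (by rw [pow_succ']; exact Ideal.mul_mem_mul ha hr)

variable [IsNoetherianRing R]

lemma exact {s : Finset R} (hs : Ideal.span (s : Set R) = 𝔪) (C : CechComplex D N (s : Set R))
    (hN : ∀ i, ExtVan R i κ N) (i : ℕ) :
    LinearMap.ker (C.d (i + 1)) = LinearMap.range (C.d i) ∧
      ∀ n, ExtVan R n κ (LinearMap.range (C.d i)) := by
  have key : ∀ i, (∀ n, ExtVan R n κ (LinearMap.range (C.d i))) →
      (∀ n, ExtVan R n κ (C.X (i + 1) ⧸ LinearMap.range (C.d i))) ∧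
        LinearMap.ker (C.d (i + 1)) = LinearMap.range (C.d i) := by
    intro i h
    have hX : ∀ n, ExtVan R n κ (C.X (i + 1)) := by
      cases i with
      | zero => exact fun n => (hN n).congr_right C.equiv
      | succ i => exact (C.bothVan i).1
    have hq : ∀ n, ExtVan R n κ (C.X (i + 1) ⧸ LinearMap.range (C.d i)) := fun n =>
      ExtVan.cov_right (Submodule.injective_subtype _) (LinearMap.exact_subtype_mkQ _)
        (Submodule.mkQ_surjective _) (hX n) (h (n + 1))
    refine ⟨hq, le_antisymm (fun z hz => ?_) (LinearMap.range_le_ker_iff.2 (C.comp_eq_zero i))⟩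
    let J : Ideal R := (LinearMap.range (C.d i)).comap (LinearMap.toSpanSingleton R _ z)
    have hJ : 𝔪 ≤ J.radical := by
      rw [← hs, Ideal.span_le]
      intro x hx
      obtain ⟨t, ht⟩ := C.torsion x hx i z hz
      exact ⟨t, ht⟩
    obtain ⟨t, ht⟩ := Ideal.exists_pow_le_of_le_radical_of_fg hJ (IsNoetherian.noetherian _)
    rw [← Submodule.Quotient.mk_eq_zero]
    refine eq_zero_of_pow (hq 0) t _ fun r hr => ?_
    rw [← Submodule.Quotient.mk_smul, Submodule.Quotient.mk_eq_zero]
    exact ht hr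
  have h : ∀ n, ExtVan R n κ (LinearMap.range (C.d i)) := by
    induction i with
    | zero =>
      have := C.subsingleton_zero
      have : Subsingleton (LinearMap.range (C.d 0)) :=
        (LinearMap.surjective_rangeRestrict (C.d 0)).subsingleton
      exact fun n => ExtVan.of_subsingleton n
    | succ i ih =>
      obtain ⟨h1, h2⟩ := key i ih
      exact fun n => (h1 n).congr_right
        ((Submodule.quotEquivOfEq _ _ h2.symm).trans (C.d (i + 1)).quotKerEquivRange)
  exact ⟨(key i h).2, h⟩

end CechComplex

variable [IsNoetherianRing R]

theorem torVan_of_forall_extVan (N : Type) [AddCommGroup N] [Module R N]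
    (hN : ∀ i, ExtVan R i κ N) (j : ℕ) : D.TorVan j N := by
  obtain ⟨s, hs⟩ := IsNoetherian.noetherian 𝔪
  obtain ⟨C⟩ := CechComplex.exists_of_finset (D := D) (N := N) s
    fun x hx => hs ▸ Ideal.subset_span hx
  have hex := fun i => (C.exact hs hN i).1
  obtain ⟨n, hn⟩ := C.bounded
  have hrange : ∀ m i j, n ≤ i + m → D.TorVan j (LinearMap.range (C.d (i + 1))) := by
    intro m
    induction m with
    | zero =>
      intro i j hi
      have := hn (i + 1) (by omega)
      have : Subsingleton (LinearMap.range (C.d (i + 1))) :=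
        (LinearMap.surjective_rangeRestrict (C.d (i + 1))).subsingleton
      exact HomExact.of_subsingleton
    | succ m ih =>
      intro i j hi
      refine HomExact.left (D.comp_eq_zero _) (Submodule.injective_subtype _)
        (g := (C.d (i + 2)).rangeRestrict) (fun z => ?_)
        (LinearMap.surjective_rangeRestrict _) ((C.bothVan i).2 j) (ih (i + 1) (j + 1) (by omega))
      have hz : z ∈ LinearMap.ker (C.d (i + 2)) ↔ z ∈ LinearMap.range (C.d (i + 1)) := by
        rw [hex (i + 1)]
      rw [← LinearMap.mem_ker, LinearMap.ker_rangeRestrict, hz]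
      simp
  have hinj : Function.Injective (C.d 1) := by
    rw [← LinearMap.ker_eq_bot, hex 0, LinearMap.range_eq_bot]
    have := C.subsingleton_zero
    ext x
    rw [Subsingleton.elim x 0, map_zero, map_zero]
  exact HomExact.congr ((C.equiv.trans (LinearEquiv.ofInjective _ hinj)).symm)
    (hrange n 0 j (by omega))

end DualComplex

end Cech

section FiniteResolution

namespace FiniteResolution

/-- A map from a finite free module. -/
structure Stage (R : Type) [CommRing R] where
  /-- The rank of the source. -/
  rank : ℕ
  /-- The target. -/
  tgt : ModuleCat.{0} R
  /-- The map. -/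
  map : (Fin rank → R) →ₗ[R] tgt

lemma exists_range_eq {M : Type} [AddCommGroup M] [Module R M] (N : Submodule R M) (hN : N.FG) :
    ∃ (m : ℕ) (f : (Fin m → R) →ₗ[R] M), LinearMap.range f = N := by
  have := Module.Finite.iff_fg.2 hN
  obtain ⟨m, f, hf⟩ := Module.Finite.exists_fin' R N
  exact ⟨m, N.subtype ∘ₗ f, by
    rw [LinearMap.range_comp, LinearMap.range_eq_top.2 hf, Submodule.map_top,
      Submodule.range_subtype]⟩

variable [IsNoetherianRing R]

/-- A presentation of the kernel. -/
def Stage.next (s : Stage R) : Stage R where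
  rank := (exists_range_eq (LinearMap.ker s.map) (IsNoetherian.noetherian _)).choose
  tgt := ModuleCat.of R (Fin s.rank → R)
  map := (exists_range_eq (LinearMap.ker s.map) (IsNoetherian.noetherian _)).choose_spec.choose

lemma Stage.range_next (s : Stage R) : LinearMap.range s.next.map = LinearMap.ker s.map :=
  (exists_range_eq (LinearMap.ker s.map) (IsNoetherian.noetherian _)).choose_spec.choose_spec

variable (M : Type) [AddCommGroup M] [Module R M] [Module.Finite R M]

/-- The successive maps in a resolution by finite free modules. -/
def stage : ℕ → Stage R
  | 0 => ⟨_, ModuleCat.of R M, (Module.Finite.exists_fin' R M).choose_spec.choose⟩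
  | n + 1 => (stage n).next

/-- The terms of a resolution by finite free modules. -/
abbrev term (n : ℕ) : ModuleCat.{0} R := ModuleCat.of R (Fin (stage (R := R) M n).rank → R)

/-- The differentials in a resolution by finite free modules. -/
def diff (n : ℕ) : term (R := R) M (n + 1) ⟶ term M n :=
  ModuleCat.ofHom (stage M (n + 1)).map

/-- The augmentation. -/
def aug : term (R := R) M 0 ⟶ ModuleCat.of R M := ModuleCat.ofHom (stage M 0).map

lemma aug_surjective : Function.Surjective (aug (R := R) M).hom :=
  (Module.Finite.exists_fin' R M).choose_spec.choose_spec

lemma range_diff_zero : LinearMap.range (diff (R := R) M 0).hom = LinearMap.ker (aug M).hom :=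
  (stage M 0).range_next

lemma range_diff (n : ℕ) :
    LinearMap.range (diff (R := R) M (n + 1)).hom = LinearMap.ker (diff M n).hom :=
  (stage M (n + 1)).range_next

lemma diff_diff (n : ℕ) : diff (R := R) M (n + 1) ≫ diff M n = 0 := by
  ext1
  exact LinearMap.range_le_ker_iff.1 (range_diff M n).le

lemma diff_aug : diff (R := R) M 0 ≫ aug M = 0 := by
  ext1
  exact LinearMap.range_le_ker_iff.1 (range_diff_zero M).le

/-- The complex of a resolution by finite free modules. -/
def complex : ChainComplex (ModuleCat.{0} R) ℕ :=
  ChainComplex.of (term M) (diff M) (diff_diff M)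

lemma complex_d (n : ℕ) : (complex (R := R) M).d (n + 1) n = diff M n :=
  ChainComplex.of_d _ _ _

lemma complex_exactAt_succ (n : ℕ) : (complex (R := R) M).ExactAt (n + 1) := by
  rw [HomologicalComplex.exactAt_iff' _ (n + 1 + 1) (n + 1) n (by simp) (by simp),
    ShortComplex.moduleCat_exact_iff_range_eq_ker]
  change LinearMap.range ((complex (R := R) M).d (n + 2) (n + 1)).hom =
    LinearMap.ker ((complex (R := R) M).d (n + 1) n).hom
  rw [complex_d, complex_d]
  exact range_diff M n

/-- A resolution by finite free modules. -/
def resolution : ProjectiveResolution (ModuleCat.of R M) where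
  complex := complex M
  projective n := (IsProjective.iff_projective (R := R) (Fin (stage (R := R) M n).rank → R)).1
    inferInstance
  π := (ChainComplex.toSingle₀Equiv _ _).symm ⟨aug M, by rw [complex_d]; exact diff_aug M⟩
  quasiIso := ⟨fun n => by
    cases n
    · rw [ChainComplex.quasiIsoAt₀_iff, ShortComplex.quasiIso_iff_of_zeros']
      · refine (ShortComplex.exact_and_epi_g_iff_of_iso
          (S₂ := ShortComplex.mk _ _ (diff_aug (R := R) M)) ?_).2 ⟨?_, ?_⟩
        · exact ShortComplex.isoMk (Iso.refl _) (Iso.refl _) (Iso.refl _)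
            ((Category.id_comp _).trans ((complex_d M 0).symm.trans (Category.comp_id _).symm))
            ((Category.id_comp _).trans
              ((ChainComplex.toSingle₀Equiv_symm_apply_f_zero (C := complex M) _ _).symm.trans
                (Category.comp_id _).symm))
        · rw [ShortComplex.moduleCat_exact_iff_range_eq_ker]
          exact range_diff_zero M
        · exact (ModuleCat.epi_iff_surjective _).2 (aug_surjective M)
      all_goals rfl
    · rw [quasiIsoAt_iff_exactAt']
      · apply complex_exactAt_succ
      · apply ChainComplex.exactAt_succ_single_obj⟩

instance (n : ℕ) : Module.Finite R ((resolution (R := R) M).complex.X n) :=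
  inferInstanceAs (Module.Finite R (Fin _ → R))

instance (n : ℕ) : Module.Free R ((resolution (R := R) M).complex.X n) :=
  inferInstanceAs (Module.Free R (Fin _ → R))

end FiniteResolution

end FiniteResolution

section Dual

variable [IsLocalRing R]

variable (P : ProjectiveResolution (ModuleCat.of R (IsLocalRing.ResidueField R)))

/-- The terms of the dual of a resolution, preceded by a zero term. -/
def dualTerm : ℕ → ModuleCat.{0} R
  | 0 => ModuleCat.of R PUnit
  | j + 1 => ModuleCat.of R (Module.Dual R (P.complex.X j))

/-- The differentials of the dual of a resolution. -/
def dualDiff : ∀ j, dualTerm P j →ₗ[R] dualTerm P (j + 1)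
  | 0 => 0
  | j + 1 => Module.Dual.transpose (P.complex.d (j + 1) j).hom

lemma exists_resolution_homotopy {r : R} (hr : r ∈ 𝔪) :
    ∃ s : ∀ j, P.complex.X j →ₗ[R] P.complex.X (j + 1),
      r • LinearMap.id = (P.complex.d 1 0).hom ∘ₗ s 0 ∧
      ∀ j, r • LinearMap.id = (P.complex.d (j + 2) (j + 1)).hom ∘ₗ s (j + 1) +
        s j ∘ₗ (P.complex.d (j + 1) j).hom := by
  have hπ : r • P.π = 0 := by
    refine HomologicalComplex.to_single_hom_ext ?_
    ext x
    exact smul_residueField_eq_zero hr _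
  let H : Homotopy (r • 𝟙 P.complex) 0 := ProjectiveResolution.liftHomotopy 0 _ _
    (by
      rw [Functor.map_zero, Limits.comp_zero, Linear.smul_comp, Category.id_comp, hπ])
    (by rw [Functor.map_zero, Limits.comp_zero, Limits.zero_comp])
  refine ⟨fun j => (H.hom j (j + 1)).hom, ?_, fun j => ?_⟩
  · have h := H.comm 0
    rw [dNext_eq_zero _ _ (by simp), prevD_eq _ (show (ComplexShape.down ℕ).Rel 1 0 from rfl)] at h
    simp only [HomologicalComplex.zero_f, zero_add, add_zero] at h
    exact congrArg ModuleCat.Hom.hom h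
  · have h := H.comm (j + 1)
    rw [dNext_eq _ (show (ComplexShape.down ℕ).Rel (j + 1) j from rfl),
      prevD_eq _ (show (ComplexShape.down ℕ).Rel (j + 2) (j + 1) from rfl)] at h
    simp only [HomologicalComplex.zero_f, add_zero] at h
    exact (congrArg ModuleCat.Hom.hom h).trans (add_comm _ _)

variable [∀ n, Module.Finite R (P.complex.X n)] [∀ n, Module.Free R (P.complex.X n)]

/-- The dual of a resolution of the residue field by finite free modules. -/
def DualComplex.ofResolution : DualComplex R where
  G j := dualTerm P j
  projective
    | 0 => inferInstanceAs (Module.Projective R PUnit)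
    | j + 1 => inferInstanceAs (Module.Projective R (Module.Dual R (P.complex.X j)))
  subsingleton_zero := inferInstanceAs (Subsingleton PUnit)
  δ := dualDiff P
  comp_eq_zero
    | 0 => LinearMap.comp_zero _
    | j + 1 => by
      refine LinearMap.ext fun (φ : Module.Dual R (P.complex.X j)) => ?_
      change (φ ∘ₗ (P.complex.d (j + 1) j).hom) ∘ₗ (P.complex.d (j + 2) (j + 1)).hom = 0
      rw [LinearMap.comp_assoc, ← ModuleCat.hom_comp, P.complex.d_comp_d, ModuleCat.hom_zero,
        LinearMap.comp_zero]
  exists_homotopy r hr j := by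
    obtain ⟨s, h0, h1⟩ := exists_resolution_homotopy P hr
    cases j with
    | zero =>
      refine ⟨0, Module.Dual.transpose (s 0),
        LinearMap.ext fun (φ : Module.Dual R (P.complex.X 0)) => ?_⟩
      change r • φ = (φ ∘ₗ (P.complex.d 1 0).hom) ∘ₗ s 0 + 0
      rw [LinearMap.comp_assoc, ← h0, add_zero, LinearMap.comp_smul, LinearMap.comp_id]
    | succ j =>
      refine ⟨Module.Dual.transpose (s j), Module.Dual.transpose (s (j + 1)),
        LinearMap.ext fun (φ : Module.Dual R (P.complex.X (j + 1))) => ?_⟩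
      change r • φ = (φ ∘ₗ (P.complex.d (j + 2) (j + 1)).hom) ∘ₗ s (j + 1) +
        (φ ∘ₗ s j) ∘ₗ (P.complex.d (j + 1) j).hom
      rw [LinearMap.comp_assoc, LinearMap.comp_assoc, ← LinearMap.comp_add, ← h1,
        LinearMap.comp_smul, LinearMap.comp_id]

lemma DualComplex.selfVan_iff (j : ℕ) :
    (DualComplex.ofResolution P).SelfVan j ↔ ExtVan R j κ R := by
  cases j with
  | zero =>
    refine Iff.trans ?_ (subsingleton_ext_zero_iff P (ModuleCat.of R R)).symm
    constructor
    · intro h f hf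
      obtain ⟨_, h⟩ := h (x := f) hf
      exact h.symm
    · intro h f hf
      rw [h f hf]
      exact zero_mem _
  | succ j =>
    refine Iff.trans ?_ (subsingleton_ext_succ_iff P j (ModuleCat.of R R)).symm
    exact ⟨fun h f hf => h (x := f) hf, fun h f hf => h f hf⟩

end Dual

section TorComparison

section Transpose

variable {F F₀ F₁ F₂ N N' : Type} [AddCommGroup F] [Module R F] [AddCommGroup F₀] [Module R F₀]
  [AddCommGroup F₁] [Module R F₁] [AddCommGroup F₂] [Module R F₂] [AddCommGroup N] [Module R N]
  [AddCommGroup N'] [Module R N']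

variable (R F N) in
/-- The natural map `F ⊗ N → Hom(F^*, N)`. -/
def tensorDualHom : F ⊗[R] N →ₗ[R] (Module.Dual R F →ₗ[R] N) :=
  dualTensorHom R (Module.Dual R F) N ∘ₗ (Module.Dual.eval R F).rTensor N

lemma tensorDualHom_bijective [Module.Finite R F] [Module.Free R F] :
    Function.Bijective (tensorDualHom R F N) := by
  let e := (Module.evalEquiv R F).rTensor N ≪≫ₗ dualTensorHomEquiv R (Module.Dual R F) N
  have : tensorDualHom R F N = e.toLinearMap := by
    ext x n φ
    simp [tensorDualHom, e]
  rw [this]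
  exact e.bijective

lemma tensorDualHom_rTensor (d : F₁ →ₗ[R] F₀) (x : F₁ ⊗[R] N) :
    tensorDualHom R F₀ N (d.rTensor N x) = tensorDualHom R F₁ N x ∘ₗ Module.Dual.transpose d := by
  induction x with
  | zero => simp
  | add x y hx hy => simp only [map_add, hx, hy, LinearMap.add_comp]
  | tmul x n => exact LinearMap.ext fun φ => rfl

lemma tensorDualHom_lTensor (g : N →ₗ[R] N') (x : F ⊗[R] N) :
    tensorDualHom R F N' (g.lTensor F x) = g ∘ₗ tensorDualHom R F N x := by
  induction x with
  | zero => simp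
  | add x y hx hy => simp only [map_add, hx, hy, LinearMap.comp_add]
  | tmul x n => ext φ; simp [tensorDualHom]

variable [Module.Finite R F₀] [Module.Free R F₀] [Module.Finite R F₁] [Module.Free R F₁]
  [Module.Finite R F₂] [Module.Free R F₂]

lemma homExact_transpose_iff (d₁ : F₁ →ₗ[R] F₀) (d₂ : F₂ →ₗ[R] F₁) :
    HomExact (Module.Dual.transpose d₁) (Module.Dual.transpose d₂) N ↔
      ∀ z, d₁.rTensor N z = 0 → ∃ y, d₂.rTensor N y = z := by
  constructor
  · intro h z hz
    obtain ⟨g, hg⟩ := h (tensorDualHom R F₁ N z) (by rw [← tensorDualHom_rTensor, hz, map_zero])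
    obtain ⟨y, rfl⟩ := tensorDualHom_bijective.2 g
    exact ⟨y, tensorDualHom_bijective.1 (by rw [tensorDualHom_rTensor, hg])⟩
  · intro h f hf
    obtain ⟨z, rfl⟩ := tensorDualHom_bijective.2 f
    obtain ⟨y, rfl⟩ := h z (tensorDualHom_bijective.1
      (by rw [tensorDualHom_rTensor, hf, map_zero]))
    exact ⟨_, (tensorDualHom_rTensor _ _).symm⟩

lemma homExact_zero_transpose_iff {A : Type} [AddCommGroup A] [Module R A] (d₁ : F₁ →ₗ[R] F₀) :
    HomExact (0 : A →ₗ[R] _) (Module.Dual.transpose d₁) N ↔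
      Function.Surjective (d₁.rTensor N) := by
  constructor
  · intro h z
    obtain ⟨g, hg⟩ := h (tensorDualHom R F₀ N z) (LinearMap.comp_zero _)
    obtain ⟨y, rfl⟩ := tensorDualHom_bijective.2 g
    exact ⟨y, tensorDualHom_bijective.1 (by rw [tensorDualHom_rTensor, hg])⟩
  · intro h f _
    obtain ⟨z, rfl⟩ := tensorDualHom_bijective.2 f
    obtain ⟨y, rfl⟩ := h z
    exact ⟨_, (tensorDualHom_rTensor _ _).symm⟩

end Transpose

section Shift

variable {A B C N₁ N₂ N₃ : Type} [AddCommGroup A] [Module R A] [AddCommGroup B] [Module R B]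
  [AddCommGroup C] [Module R C] [AddCommGroup N₁] [Module R N₁] [AddCommGroup N₂] [Module R N₂]
  [AddCommGroup N₃] [Module R N₃]
  {b : A →ₗ[R] B} {c : B →ₗ[R] C} {f : N₁ →ₗ[R] N₂} {g : N₂ →ₗ[R] N₃}

/-- Whether a map into `N₁` extends along `b` can be tested in `N₂`. -/
def ReflectsExtension (b : A →ₗ[R] B) (f : N₁ →ₗ[R] N₂) : Prop :=
  ∀ z : A →ₗ[R] N₁, (∃ q : B →ₗ[R] N₂, q ∘ₗ b = f ∘ₗ z) → ∃ w : B →ₗ[R] N₁, w ∘ₗ b = z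

lemma homExact_iff_reflectsExtension [Module.Projective R B] [Module.Projective R C]
    (hcb : c ∘ₗ b = 0) (hf : Function.Injective f) (hfg : Function.Exact f g)
    (hg : Function.Surjective g) (h2 : HomExact b c N₂) :
    HomExact b c N₃ ↔ ReflectsExtension b f := by
  constructor
  · rintro h z ⟨q, hq⟩
    obtain ⟨e, he⟩ := h (g ∘ₗ q) (by
      rw [LinearMap.comp_assoc, hq, ← LinearMap.comp_assoc, hfg.linearMap_comp_eq_zero,
        LinearMap.zero_comp])
    obtain ⟨e', rfl⟩ := Module.projective_lifting_property g e hg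
    obtain ⟨w, hw⟩ := exists_lift_of_exact hf hfg (q - e' ∘ₗ c) (by
      rw [LinearMap.comp_sub, ← LinearMap.comp_assoc, he, sub_self])
    refine ⟨w, ?_⟩
    rw [← LinearMap.cancel_left hf, ← LinearMap.comp_assoc, hw, LinearMap.sub_comp, hq,
      LinearMap.comp_assoc, hcb, LinearMap.comp_zero, sub_zero]
  · intro h u hu
    obtain ⟨u', rfl⟩ := Module.projective_lifting_property g u hg
    obtain ⟨z, hz⟩ := exists_lift_of_exact hf hfg (u' ∘ₗ b) (by rw [← LinearMap.comp_assoc, hu])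
    obtain ⟨w, rfl⟩ := h z ⟨u', hz.symm⟩
    obtain ⟨e, he⟩ := h2 (u' - f ∘ₗ w) (by
      rw [LinearMap.sub_comp, LinearMap.comp_assoc, hz, sub_self])
    refine ⟨g ∘ₗ e, ?_⟩
    rw [LinearMap.comp_assoc, he, LinearMap.comp_sub, ← LinearMap.comp_assoc w f g,
      hfg.linearMap_comp_eq_zero, LinearMap.zero_comp, sub_zero]

lemma reflectsExtension_transpose_iff {F₀ F₁ X : Type} [AddCommGroup F₀] [Module R F₀]
    [AddCommGroup F₁] [Module R F₁] [AddCommGroup X] [Module R X] [Module.Finite R F₀]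
    [Module.Free R F₀] [Module.Finite R F₁] [Module.Free R F₁] {d : F₁ →ₗ[R] F₀} {p : F₀ →ₗ[R] X}
    (hdp : Function.Exact d p) (hp : Function.Surjective p) :
    ReflectsExtension (Module.Dual.transpose d) f ↔ Function.Injective (f.lTensor X) := by
  have hcomm (ζ : F₀ ⊗[R] N₁) : f.lTensor X (p.rTensor N₁ ζ) = p.rTensor N₂ (f.lTensor F₀ ζ) := by
    rw [← LinearMap.comp_apply, ← LinearMap.comp_apply, LinearMap.lTensor_comp_rTensor,
      LinearMap.rTensor_comp_lTensor]
  constructor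
  · intro h
    rw [injective_iff_map_eq_zero]
    intro t ht
    obtain ⟨ζ, rfl⟩ := LinearMap.rTensor_surjective N₁ hp t
    rw [hcomm] at ht
    obtain ⟨y, hy⟩ := (rTensor_exact N₂ hdp hp _).1 ht
    obtain ⟨w, hw⟩ := h (tensorDualHom R F₀ N₁ ζ) ⟨tensorDualHom R F₁ N₂ y, by
      rw [← tensorDualHom_rTensor, hy, tensorDualHom_lTensor]⟩
    obtain ⟨y', rfl⟩ := tensorDualHom_bijective.2 w
    rw [← tensorDualHom_rTensor] at hw
    exact (rTensor_exact N₁ hdp hp _).2 ⟨y', tensorDualHom_bijective.1 hw⟩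
  · rintro h z ⟨q, hq⟩
    obtain ⟨ζ, rfl⟩ := tensorDualHom_bijective.2 z
    obtain ⟨y, rfl⟩ := tensorDualHom_bijective.2 q
    rw [← tensorDualHom_rTensor, ← tensorDualHom_lTensor] at hq
    have h0 : p.rTensor N₁ ζ = 0 := by
      refine (injective_iff_map_eq_zero _).1 h _ ?_
      rw [hcomm]
      exact (rTensor_exact N₂ hdp hp _).2 ⟨y, tensorDualHom_bijective.1 hq⟩
    obtain ⟨y', rfl⟩ := (rTensor_exact N₁ hdp hp _).1 h0
    exact ⟨_, (tensorDualHom_rTensor _ _).symm⟩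

lemma injective_lTensor_range_iff {F₀ F₁ F₂ : Type} (X : Type) [AddCommGroup F₀] [Module R F₀]
    [AddCommGroup F₁] [Module R F₁] [AddCommGroup F₂] [Module R F₂] [AddCommGroup X] [Module R X]
    {d₂ : F₂ →ₗ[R] F₁} {d₁ : F₁ →ₗ[R] F₀} (h : Function.Exact d₂ d₁) :
    (∀ z, d₁.lTensor X z = 0 → ∃ y, d₂.lTensor X y = z) ↔
      Function.Injective ((LinearMap.range d₁).subtype.lTensor X) := by
  have hex : Function.Exact d₂ d₁.rangeRestrict := fun x => by
    rw [← h x, Subtype.ext_iff]; rfl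
  have hs : Function.Surjective d₁.rangeRestrict := d₁.surjective_rangeRestrict
  have hfac (z) : d₁.lTensor X z =
      (LinearMap.range d₁).subtype.lTensor X (d₁.rangeRestrict.lTensor X z) := by
    rw [← LinearMap.lTensor_comp_apply]; rfl
  constructor
  · intro h'
    rw [injective_iff_map_eq_zero]
    intro t ht
    obtain ⟨z, rfl⟩ := LinearMap.lTensor_surjective X hs t
    obtain ⟨y, rfl⟩ := h' z (by rw [hfac, ht])
    exact (lTensor_exact X hex hs _).2 ⟨y, rfl⟩
  · intro h' z hz
    rw [hfac] at hz
    exact (lTensor_exact X hex hs _).1 ((injective_iff_map_eq_zero _).1 h' _ hz)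

end Shift

variable (X : ModuleCat.{0} R) {N : Type} [AddCommGroup N] [Module R N]
  (Q : ProjectiveResolution (ModuleCat.of R N))

lemma subsingleton_torModule_succ_iff (n : ℕ) :
    Subsingleton (torModule R (n + 1) X (ModuleCat.of R N)) ↔
      ∀ z, (Q.complex.d (n + 1) n).hom.lTensor X z = 0 →
        ∃ y, (Q.complex.d (n + 2) (n + 1)).hom.lTensor X y = z := by
  have e := Q.isoLeftDerivedObj ((MonoidalCategory.tensoringLeft (ModuleCat.{0} R)).obj X) (n + 1)
  rw [torModule]
  refine e.toLinearEquiv.toEquiv.subsingleton_congr.trans ?_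
  rw [← ModuleCat.isZero_iff_subsingleton]
  refine (HomologicalComplex.exactAt_iff_isZero_homology _ _).symm.trans ?_
  rw [HomologicalComplex.exactAt_iff' _ (n + 2) (n + 1) n (by simp) (by simp),
    ShortComplex.moduleCat_exact_iff]
  exact Iff.rfl

lemma subsingleton_torModule_zero_iff :
    Subsingleton (torModule R 0 X (ModuleCat.of R N)) ↔
      Function.Surjective ((Q.complex.d 1 0).hom.lTensor X) := by
  have e := Q.isoLeftDerivedObj ((MonoidalCategory.tensoringLeft (ModuleCat.{0} R)).obj X) 0
  rw [torModule]
  refine e.toLinearEquiv.toEquiv.subsingleton_congr.trans ?_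
  rw [← ModuleCat.isZero_iff_subsingleton]
  refine (HomologicalComplex.exactAt_iff_isZero_homology _ _).symm.trans ?_
  rw [HomologicalComplex.exactAt_iff' _ 1 0 0 (by simp) (by simp),
    ShortComplex.moduleCat_exact_iff]
  constructor
  · intro h z
    refine h z ?_
    change (Q.complex.d 0 0).hom.lTensor X z = 0
    rw [Q.complex.shape 0 0 (by simp), ModuleCat.hom_zero, LinearMap.lTensor_zero,
      LinearMap.zero_apply]
  · intro h z _
    exact h z

end TorComparison

section ResolutionMaps

variable {X : Type} [AddCommGroup X] [Module R X]
  (Q : ProjectiveResolution (ModuleCat.of R X))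

namespace CategoryTheory.ProjectiveResolution

lemma exact_d (j : ℕ) :
    Function.Exact (Q.complex.d (j + 2) (j + 1)).hom (Q.complex.d (j + 1) j).hom :=
  (ShortComplex.ShortExact.moduleCat_exact_iff_function_exact _).1 (Q.exact_succ j)

/-- The augmentation as a linear map. -/
def augmentation : Q.complex.X 0 →ₗ[R] X := (Q.π.f 0).hom

lemma exact_augmentation : Function.Exact (Q.complex.d 1 0).hom Q.augmentation :=
  (ShortComplex.ShortExact.moduleCat_exact_iff_function_exact _).1 Q.exact₀

lemma augmentation_surjective : Function.Surjective Q.augmentation :=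
  (ModuleCat.epi_iff_surjective _).1 (inferInstanceAs (Epi (Q.π.f 0)))

instance projective_term (j : ℕ) : Module.Projective R (Q.complex.X j) :=
  (IsProjective.iff_projective (R := R) (Q.complex.X j)).2 (Q.projective j)

end CategoryTheory.ProjectiveResolution

end ResolutionMaps

section TorVan

variable [IsLocalRing R]

variable (P : ProjectiveResolution (ModuleCat.of R (IsLocalRing.ResidueField R)))
  [∀ n, Module.Finite R (P.complex.X n)] [∀ n, Module.Free R (P.complex.X n)]
  {N Z Q W : Type} [AddCommGroup N] [Module R N] [AddCommGroup Z] [Module R Z]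
  [AddCommGroup Q] [Module R Q] [AddCommGroup W] [Module R W]

namespace DualComplex

lemma torVan_succ_of_flat [Module.Flat R Q] (j : ℕ) : (ofResolution P).TorVan (j + 1) Q :=
  (homExact_transpose_iff (N := Q) (P.complex.d (j + 1) j).hom
    (P.complex.d (j + 2) (j + 1)).hom).2
    fun z hz => (Module.Flat.rTensor_exact Q (P.exact_d j) z).1 hz

variable {f : Z →ₗ[R] Q} {g : Q →ₗ[R] W}

lemma torVan_succ_succ_iff [Module.Flat R Q] (hf : Function.Injective f)
    (hfg : Function.Exact f g) (hg : Function.Surjective g) (j : ℕ) :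
    (ofResolution P).TorVan (j + 2) W ↔ (ofResolution P).TorVan (j + 1) Z :=
  ⟨fun h => HomExact.left ((ofResolution P).comp_eq_zero (j + 2)) hf hfg hg
      (torVan_succ_of_flat P j) h,
    fun h => HomExact.right ((ofResolution P).comp_eq_zero (j + 1)) hf hfg hg h
      (torVan_succ_of_flat P (j + 1))⟩

lemma torVan_one_iff [Module.Flat R Q] (hf : Function.Injective f)
    (hfg : Function.Exact f g) (hg : Function.Surjective g) :
    (ofResolution P).TorVan 1 W ↔ Function.Injective (f.lTensor κ) :=
  (homExact_iff_reflectsExtension ((ofResolution P).comp_eq_zero 1) hf hfg hg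
    (torVan_succ_of_flat P 0)).trans
    (reflectsExtension_transpose_iff P.exact_augmentation P.augmentation_surjective)

lemma torVan_zero_iff : (ofResolution P).TorVan 0 N ↔ Subsingleton (κ ⊗[R] N) := by
  refine (homExact_zero_transpose_iff (N := N) (A := PUnit) (P.complex.d 1 0).hom).trans ?_
  have hex := rTensor_exact N P.exact_augmentation P.augmentation_surjective
  have hs := LinearMap.rTensor_surjective N P.augmentation_surjective
  constructor
  · intro h
    refine subsingleton_of_forall_eq 0 fun t => ?_
    obtain ⟨z, rfl⟩ := hs t
    obtain ⟨y, rfl⟩ := h z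
    exact hex.apply_apply_eq_zero y
  · intro h z
    exact (hex z).1 (Subsingleton.elim _ _)

variable (T : ProjectiveResolution (ModuleCat.of R N))

lemma torVan_succ_iff_injective (i j : ℕ) :
    (ofResolution P).TorVan (j + 1) (LinearMap.range (T.complex.d (i + 1) i).hom) ↔
      Function.Injective
        ((LinearMap.range (T.complex.d (i + 2 + j) (i + 1 + j)).hom).subtype.lTensor κ) := by
  have hex (i : ℕ) : Function.Exact
      (LinearMap.range (T.complex.d (i + 2) (i + 1)).hom).subtype
      (T.complex.d (i + 1) i).hom.rangeRestrict := fun x => by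
    rw [Submodule.coe_subtype, Subtype.range_coe, SetLike.mem_coe, LinearMap.mem_range,
      ← Set.mem_range, ← T.exact_d i x, Subtype.ext_iff]
    rfl
  induction j generalizing i with
  | zero =>
    exact torVan_one_iff P (Submodule.subtype_injective _) (hex i)
      (LinearMap.surjective_rangeRestrict _)
  | succ j ih =>
    refine (torVan_succ_succ_iff P (Submodule.subtype_injective _) (hex i)
      (LinearMap.surjective_rangeRestrict _) j).trans ((ih (i + 1)).trans ?_)
    rw [show i + 1 + 2 + j = i + 2 + (j + 1) by omega,
      show i + 1 + 1 + j = i + 1 + (j + 1) by omega]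

theorem torVan_iff (j : ℕ) :
    (ofResolution P).TorVan j N ↔ Subsingleton (torModule R j (ModuleCat.of R κ)
      (ModuleCat.of R N)) := by
  let T := ProjectiveResolution.of (ModuleCat.of R N)
  have hex : Function.Exact (LinearMap.range (T.complex.d 1 0).hom).subtype T.augmentation :=
    fun x => by
      rw [Submodule.coe_subtype, Subtype.range_coe]
      exact T.exact_augmentation x
  rcases j with _ | _ | j
  · rw [torVan_zero_iff, subsingleton_torModule_zero_iff _ T]
    have hexT := lTensor_exact κ T.exact_augmentation T.augmentation_surjective
    have hs := LinearMap.lTensor_surjective κ T.augmentation_surjective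
    constructor
    · intro h z
      exact (hexT z).1 (Subsingleton.elim _ _)
    · intro h
      refine subsingleton_of_forall_eq 0 fun t => ?_
      obtain ⟨z, rfl⟩ := hs t
      obtain ⟨y, rfl⟩ := h z
      exact hexT.apply_apply_eq_zero y
  · refine (torVan_one_iff P (Submodule.subtype_injective _) hex
      T.augmentation_surjective).trans (Iff.symm ?_)
    exact (subsingleton_torModule_succ_iff _ T 0).trans
      (injective_lTensor_range_iff κ (T.exact_d 0))
  · refine (torVan_succ_succ_iff P (Submodule.subtype_injective _) hex
      T.augmentation_surjective j).trans ((torVan_succ_iff_injective P T 0 j).trans (Iff.symm ?_))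
    rw [show 0 + 2 + j = j + 2 by omega, show 0 + 1 + j = j + 1 by omega]
    exact (subsingleton_torModule_succ_iff _ T (j + 1)).trans
      (injective_lTensor_range_iff κ (T.exact_d (j + 1)))

end DualComplex

end TorVan

section Extremal

variable {k M : ModuleCat.{0} R} {s : ℕ}

lemma edepth_eq_coe (hlt : ∀ j < s, Subsingleton (extModule R j k M))
    (hs : ¬ Subsingleton (extModule R s k M)) : edepth R k M = (s : EReal) := by
  refine IsLeast.csInf_eq ⟨⟨s, rfl, not_subsingleton_iff_nontrivial.1 hs⟩, ?_⟩
  rintro _ ⟨i, rfl, hi⟩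
  by_contra! h
  exact not_subsingleton_iff_nontrivial.2 hi (hlt i (by exact_mod_cast h))

lemma ewidth_eq_coe (hlt : ∀ j < s, Subsingleton (torModule R j k M))
    (hs : ¬ Subsingleton (torModule R s k M)) : ewidth R k M = (s : EReal) := by
  refine IsLeast.csInf_eq ⟨⟨s, rfl, not_subsingleton_iff_nontrivial.1 hs⟩, ?_⟩
  rintro _ ⟨i, rfl, hi⟩
  by_contra! h
  exact not_subsingleton_iff_nontrivial.2 hi (hlt i (by exact_mod_cast h))

lemma extSup_eq_coe (hlt : ∀ j, s < j → Subsingleton (extModule R j k M))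
    (hs : ¬ Subsingleton (extModule R s k M)) : extSup R k M = (s : EReal) := by
  refine IsGreatest.csSup_eq ⟨⟨s, rfl, not_subsingleton_iff_nontrivial.1 hs⟩, ?_⟩
  rintro _ ⟨i, rfl, hi⟩
  by_contra! h
  exact not_subsingleton_iff_nontrivial.2 hi (hlt i (by exact_mod_cast h))

lemma ewidth_eq_top (h : ∀ j, Subsingleton (torModule R j k M)) : ewidth R k M = ⊤ := by
  rw [ewidth, sInf_eq_top]
  rintro _ ⟨i, rfl, hi⟩
  exact absurd (h i) (not_subsingleton_iff_nontrivial.2 hi)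

lemma extSup_eq_bot (h : ∀ j, Subsingleton (extModule R j k M)) : extSup R k M = ⊥ := by
  rw [extSup, sSup_eq_bot]
  rintro _ ⟨i, rfl, hi⟩
  exact absurd (h i) (not_subsingleton_iff_nontrivial.2 hi)

end Extremal

section Main

variable [IsNoetherianRing R] [IsLocalRing R]

variable (R) in
lemma exists_not_extVan_self : ∃ d, ¬ ExtVan R d κ R := by
  by_contra! h
  have h0 := (DualComplex.torVan_zero_iff (FiniteResolution.resolution κ)).1
    (DualComplex.torVan_of_forall_extVan R h 0)
  exact not_subsingleton κ (TensorProduct.rid R κ).symm.toEquiv.subsingleton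

/-- If `Ext^i(k, M)` vanishes for large `i`, the last nonvanishing degree is
`depth R - width M`. -/
theorem extSup_eq_edepth_sub_ewidth (M : Type) [AddCommGroup M] [Module R M] (n : ℕ)
    (h : ∀ i, n ≤ i → ExtVan R i κ M) :
    extSup R (ModuleCat.of R κ) (ModuleCat.of R M)
      = edepth R (ModuleCat.of R κ) (ModuleCat.of R R)
        - ewidth R (ModuleCat.of R κ) (ModuleCat.of R M) := by
  classical
  let D := DualComplex.ofResolution (FiniteResolution.resolution (R := R) κ)
  have hext (i : ℕ) (N : Type) [AddCommGroup N] [Module R N] :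
      Subsingleton (extModule R i (ModuleCat.of R κ) (ModuleCat.of R N)) ↔ ExtVan R i κ N :=
    subsingleton_extModule_iff _ _ _
  have htor (i : ℕ) := DualComplex.torVan_iff (FiniteResolution.resolution (R := R) κ) (N := M) i
  have hself := DualComplex.selfVan_iff (FiniteResolution.resolution (R := R) κ)
  let d := Nat.find (exists_not_extVan_self R)
  have hd : ¬ ExtVan R d κ R := Nat.find_spec (exists_not_extVan_self R)
  have hlt : ∀ j < d, ExtVan R j κ R := fun j hj =>
    not_not.1 (Nat.find_min (exists_not_extVan_self R) hj)
  rw [edepth_eq_coe (s := d) (fun j hj => (hext j R).2 (hlt j hj)) (by rwa [hext])]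
  by_cases hall : ∀ i, ExtVan R i κ M
  · rw [extSup_eq_bot fun j => (hext j M).2 (hall j), ewidth_eq_top fun j => (htor j).1
      (DualComplex.torVan_of_forall_extVan M hall j), EReal.sub_top]
  · push Not at hall
    obtain ⟨i, hi⟩ := hall
    let s := Nat.findGreatest (fun i => ¬ ExtVan R i κ M) n
    have hs : ¬ ExtVan R s κ M := Nat.findGreatest_spec (P := fun i => ¬ ExtVan R i κ M)
      (le_of_not_ge fun hn => hi (h i hn)) hi
    have hs' : ∀ i, s < i → ExtVan R i κ M := fun i hsi => by
      by_contra hcon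
      exact Nat.findGreatest_is_greatest hsi (le_of_not_ge fun hn => hcon (h i hn)) hcon
    obtain ⟨hsd, hT, hT'⟩ := DualComplex.torVan_of_extVan (D := D)
      (fun j hj => (hself j).2 (hlt j hj)) (fun hD => hd ((hself d).1 hD))
      (fun N _ _ hN j => DualComplex.torVan_of_forall_extVan N hN j) s M hs hs'
    rw [extSup_eq_coe (fun j hj => (hext j M).2 (hs' j hj)) (by rwa [hext]),
      ewidth_eq_coe (s := d - s) (fun j hj => (htor j).1 (hT j (by omega)))
        (fun hcon => hT' ((htor _).2 hcon))]
    obtain ⟨t, ht⟩ := Nat.exists_eq_add_of_le hsd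
    rw [ht, Nat.add_sub_cancel_left, Nat.cast_add]
    exact (EReal.add_sub_cancel_right (b := (t : ℝ))).symm

end Main

end Helpers

/-- `(R, m, k)` local noetherian, `H^i_m(M) = 0` for `i > n`, and
`Ext^n_R(k, M) = 0`. Then `Ext^i_R(k, M) = 0` for all `i ≥ n`, and
`sup{ i : Ext^i_R(k, M) ≠ 0 } = depth R - width_R M`. -/
theorem ext_rigidity_of_localCohomology_vanishing
    (R : Type) [CommRing R] [IsNoetherianRing R] [IsLocalRing R]
    (M : Type) [AddCommGroup M] [Module R M] (n : ℕ)
    (hlc : ∀ i : ℕ, n < i → Subsingleton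
      ((localCohomology (IsLocalRing.maximalIdeal R) i).obj (ModuleCat.of R M)))
    (hvan : Subsingleton (extModule R n
      (ModuleCat.of R (IsLocalRing.ResidueField R)) (ModuleCat.of R M))) :
    (∀ i : ℕ, n ≤ i → Subsingleton (extModule R i
      (ModuleCat.of R (IsLocalRing.ResidueField R)) (ModuleCat.of R M))) ∧
    extSup R (ModuleCat.of R (IsLocalRing.ResidueField R)) (ModuleCat.of R M)
      = edepth R (ModuleCat.of R (IsLocalRing.ResidueField R)) (ModuleCat.of R R)
        - ewidth R (ModuleCat.of R (IsLocalRing.ResidueField R)) (ModuleCat.of R M) := by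
  have h : ∀ i, n ≤ i → ExtVan R i (IsLocalRing.ResidueField R) M := by
    intro i hi
    induction i, hi using Nat.le_induction with
    | base => exact (subsingleton_extModule_iff _ _ _).1 hvan
    | succ i hi ih => exact ih.succ_of_localCohomology (hlc _ (Nat.lt_succ_of_le hi))
  exact ⟨fun i hi => (subsingleton_extModule_iff _ _ _).2 (h i hi),
    extSup_eq_edepth_sub_ewidth M n h⟩
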